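/- arXiv:2411.18439 — 2 statements merged into one kernel-verified Lean document; each statement's English description precedes it below -/
import Mathlib

section
/- Let ψ: ℕ → [0,1/2) be a function with ψ(q) > 0 for all q, and assume the limit λ := lim_{q→∞} (−log ψ(q))/(log q) exists as a finite real number. Let Q ⊆ ℕ be an infinite set and define W*_Q := {x ∈ [0,1] : for infinitely many q ∈ Q there exists an integer p with gcd(p,q) = 1 and |qx − p| < ψ(q)}. Then the Hausdorff dimension of W*_Q is at least 1/(λ+1). -/
open Set Filter MeasureTheory

/-- Distance from `x` to the nearest integer. -/
noncomputable def nint (x : ℝ) : ℝ := ⨅ m : ℤ, |x - (m : ℝ)|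

/-- The `ψ`-simultaneously-well approximable set `W(n, ψ)`. -/
def Wset (n : ℕ) (ψ : ℕ → ℝ) : Set (Fin n → ℝ) :=
  {x | (∀ i, x i ∈ Set.Icc (0 : ℝ) 1) ∧
    {q : ℕ | ∀ i, nint (q * x i) < ψ q}.Infinite}

/-- The exact `ψ`-simultaneously-well approximable set `Exact(n, ψ)`. -/
def ExactSet (n : ℕ) (ψ : ℕ → ℝ) : Set (Fin n → ℝ) :=
  Wset n ψ \ ⋃ c ∈ Set.Ioo (0 : ℝ) 1, Wset n (fun q => c * ψ q)

lemma kappa_eq (q : ℕ) (hq : 0 < q) :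
    (Nat.totient q : ℝ) = ∑ d ∈ q.divisors, (ArithmeticFunction.moebius d : ℝ) * ((q:ℝ) / d) := by
  have h := (ArithmeticFunction.sum_eq_iff_sum_mul_moebius_eq (R := ℝ)
    (f := fun n => (Nat.totient n : ℝ)) (g := fun n => (n:ℝ))).1 (fun n hn => by
      have := Nat.sum_totient n
      exact_mod_cast this) q hq
  rw [← h, Nat.sum_divisorsAntidiagonal (fun a b => (ArithmeticFunction.moebius a : ℝ) * (b:ℝ))]
  refine Finset.sum_congr rfl fun d hd => ?_
  have hd' := Nat.dvd_of_mem_divisors hd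
  have hd0 : (d:ℝ) ≠ 0 := by
    have := Nat.pos_of_mem_divisors hd
    positivity
  rw [Nat.cast_div hd' hd0]

lemma moebius_coprime (q : ℕ) (hq : 0 < q) (p : ℤ) :
    (if Int.gcd p q = 1 then (1:ℝ) else 0) =
      ∑ d ∈ q.divisors, if (d:ℤ) ∣ p then (ArithmeticFunction.moebius d : ℝ) else 0 := by
  have h := congrArg (fun f => f (Int.gcd p q)) (ArithmeticFunction.coe_moebius_mul_coe_zeta (R := ℝ))
  simp only [ArithmeticFunction.coe_mul_zeta_apply, ArithmeticFunction.one_apply] at h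
  rw [← h, ← Finset.sum_filter]
  refine Finset.sum_congr ?_ fun _ _ => by simp
  ext d
  have hg : Int.gcd p q ≠ 0 := by
    intro h0
    rw [Int.gcd_eq_zero_iff] at h0
    omega
  simp only [Nat.mem_divisors, Finset.mem_filter]
  constructor
  · rintro ⟨h1, h2⟩
    refine ⟨⟨?_, hq.ne'⟩, ?_⟩
    · exact h1.trans (by exact_mod_cast Int.gcd_dvd_right p (q:ℤ))
    · exact (Int.natCast_dvd_natCast.2 h1).trans (Int.gcd_dvd_left p (q:ℤ))
  · rintro ⟨⟨h1, h2⟩, h3⟩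
    refine ⟨?_, hg⟩
    exact_mod_cast Int.dvd_coe_gcd h3 (Int.natCast_dvd_natCast.2 h1)

lemma count_int (q : ℕ) (hq : 0 < q) (u v : ℤ) (huv : u ≤ v) :
    |(((Finset.Ioc u v).filter (fun p => Int.gcd p q = 1)).card : ℝ)
      - (v - u) * (Nat.totient q / q)| ≤ q.divisors.card := by
  have hq' : (q:ℝ) ≠ 0 := by positivity
  have h1 : (((Finset.Ioc u v).filter (fun p => Int.gcd p q = 1)).card : ℝ)
      = ∑ d ∈ q.divisors, (ArithmeticFunction.moebius d : ℝ) *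
        (((Finset.Ioc u v).filter (fun p => (d:ℤ) ∣ p)).card : ℝ) := by
    rw [Finset.card_filter]
    push_cast
    simp_rw [moebius_coprime q hq]
    rw [Finset.sum_comm]
    refine Finset.sum_congr rfl fun d _ => ?_
    rw [← Finset.sum_filter, Finset.sum_const, nsmul_eq_mul, mul_comm]
  have h2 : ((v:ℝ) - u) * (Nat.totient q / q) = ∑ d ∈ q.divisors, (ArithmeticFunction.moebius d : ℝ) *
        (((v:ℝ) - u) / d) := by
    rw [kappa_eq q hq, Finset.sum_div, Finset.mul_sum]
    refine Finset.sum_congr rfl fun d _ => ?_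
    field_simp
  rw [h1, h2, ← Finset.sum_sub_distrib]
  refine (Finset.abs_sum_le_sum_abs _ _).trans ?_
  rw [Finset.card_eq_sum_ones]
  push_cast
  refine Finset.sum_le_sum fun d hd => ?_
  have hd0 := Nat.pos_of_mem_divisors hd
  rw [← mul_sub, abs_mul]
  have hm : |(ArithmeticFunction.moebius d : ℝ)| ≤ 1 := by
    exact_mod_cast ArithmeticFunction.abs_moebius_le_one (n := d)
  refine mul_le_one₀ hm (abs_nonneg _) ?_
  have hc := Int.Ioc_filter_dvd_card u v (r := d) (by exact_mod_cast hd0)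
  have hle : ⌊(u:ℚ) / (d:ℤ)⌋ ≤ ⌊(v:ℚ) / (d:ℤ)⌋ := by
    apply Int.floor_le_floor
    have : (u:ℚ) ≤ v := by exact_mod_cast huv
    gcongr
  rw [max_eq_left (by omega)] at hc
  have hc' : (((Finset.Ioc u v).filter (fun p => (d:ℤ) ∣ p)).card : ℚ) = ⌊(v:ℚ) / (d:ℤ)⌋ - ⌊(u:ℚ) / (d:ℤ)⌋ := by
    exact_mod_cast hc
  have key : |(((Finset.Ioc u v).filter (fun p => (d:ℤ) ∣ p)).card : ℚ) - ((v:ℚ) - u)/d| ≤ 1 := by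
    rw [hc', abs_le, sub_div]
    have a1 := Int.floor_le ((v:ℚ) / (d:ℤ))
    have a2 := Int.lt_floor_add_one ((v:ℚ) / (d:ℤ))
    have a3 := Int.floor_le ((u:ℚ) / (d:ℤ))
    have a4 := Int.lt_floor_add_one ((u:ℚ) / (d:ℤ))
    simp only [Int.cast_natCast] at *
    constructor <;> linarith
  exact_mod_cast key

lemma totient_mul_divisors (q : ℕ) (hq : 0 < q) : (q:ℝ) ≤ Nat.totient q * q.divisors.card := by
  have h1 := Nat.totient_eq_mul_prod_factors q
  have h2 := Nat.card_divisors hq.ne'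
  have : (q:ℚ) ≤ Nat.totient q * q.divisors.card := by
    rw [h1, h2]
    push_cast
    rw [mul_assoc, ← Finset.prod_mul_distrib]
    refine le_mul_of_one_le_right (by positivity) ?_
    refine (Finset.prod_const_one (s := q.primeFactors)).symm.le.trans ?_
    refine Finset.prod_le_prod (fun _ _ => zero_le_one) fun p hp => ?_
    have hp' := Nat.prime_of_mem_primeFactors hp
    have h3 : (2:ℚ) ≤ p := by exact_mod_cast hp'.two_le
    have h4 : (1:ℚ) ≤ q.factorization p := by
      have := hp'.factorization_pos_of_dvd hq.ne' (Nat.dvd_of_mem_primeFactors hp)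
      exact_mod_cast this
    have h5 : (p:ℚ)⁻¹ ≤ 2⁻¹ := by gcongr
    nlinarith
  exact_mod_cast this

/-- divisor bound -/
lemma divisor_bound (ε : ℝ) (hε : 0 < ε) : ∃ C : ℝ, 0 < C ∧ ∀ q : ℕ, 0 < q →
    (q.divisors.card : ℝ) ≤ C * (q:ℝ) ^ ε := by
  -- one-prime bound
  have h0 : ∃ A : ℝ, 1 ≤ A ∧ ∀ a : ℕ, (a:ℝ) + 1 ≤ A * (2:ℝ) ^ (ε * a) := by
    have hl : 0 < Real.log 2 := Real.log_pos (by norm_num)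
    refine ⟨1 + 1 / (ε * Real.log 2), by have : 0 ≤ 1 / (ε * Real.log 2) := by positivity
                                         linarith, fun a => ?_⟩
    have e1 : (2:ℝ) ^ (ε * a) = Real.exp (Real.log 2 * (ε * a)) := Real.rpow_def_of_pos (by norm_num) _
    have e2 := Real.add_one_le_exp (Real.log 2 * (ε * a))
    rw [e1]
    have h3 : (0:ℝ) < ε * Real.log 2 := by positivity
    have h4 : 0 ≤ (a:ℝ) * (ε * Real.log 2) := by positivity
    calc (a:ℝ) + 1 ≤ (1 + 1 / (ε * Real.log 2)) * (Real.log 2 * (ε * a) + 1) := by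
          field_simp
          nlinarith
      _ ≤ _ := by gcongr
  obtain ⟨A, hA1, hA⟩ := h0
  obtain ⟨B, hB⟩ := exists_nat_ge ((2:ℝ) ^ (1/ε))
  refine ⟨A ^ B, by positivity, fun q hq => ?_⟩
  have hq0 : (q:ℝ) ^ ε = ∏ p ∈ q.primeFactors, ((p:ℝ) ^ ε) ^ (q.factorization p) := by
    conv_lhs => rw [← Nat.prod_factorization_pow_eq_self hq.ne']
    rw [Finsupp.prod, Nat.cast_prod, ← Real.finsetProd_rpow _ _ (fun i _ => by positivity)]
    refine Finset.prod_congr (by simp) fun p hp => ?_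
    push_cast
    rw [← Real.rpow_natCast, ← Real.rpow_natCast, ← Real.rpow_mul (by positivity), ← Real.rpow_mul (by positivity), mul_comm]
  rw [hq0, Nat.card_divisors hq.ne']
  push_cast
  have hterm : ∀ p ∈ q.primeFactors, ((q.factorization p : ℝ) + 1) ≤
      (if p < B then A else 1) * ((p:ℝ) ^ ε) ^ (q.factorization p) := by
    intro p hp
    have hp2 : (2:ℝ) ≤ p := by exact_mod_cast (Nat.prime_of_mem_primeFactors hp).two_le
    split_ifs with h
    · refine (hA _).trans ?_
      rw [Real.rpow_mul (by norm_num), Real.rpow_natCast]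
      gcongr
    · have : (2:ℝ) ≤ (p:ℝ)^ε := by
        have hBp : (2:ℝ) ^ (1/ε) ≤ p := hB.trans (by exact_mod_cast not_lt.1 h)
        calc (2:ℝ) = ((2:ℝ) ^ (1/ε)) ^ ε := by
              rw [← Real.rpow_mul (by norm_num)]; field_simp; simp
          _ ≤ _ := by gcongr
      rw [one_mul]
      calc ((q.factorization p : ℝ) + 1) ≤ (2:ℝ) ^ (q.factorization p) := by
            exact_mod_cast (Nat.lt_two_pow_self (n := q.factorization p))
        _ ≤ _ := by gcongr
  refine (Finset.prod_le_prod (fun i _ => by positivity) hterm).trans ?_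
  rw [Finset.prod_mul_distrib]
  gcongr
  rw [Finset.prod_ite]
  simp only [Finset.prod_const, mul_one, one_pow]
  refine pow_le_pow_right₀ hA1 ?_
  calc _ ≤ (Finset.range B).card := Finset.card_le_card (fun p hp => by
          simp at hp ⊢; exact hp.2)
    _ = B := by simp

/-- closed interval of half-width `w / q` about `p / q` -/
def Iv (q : ℕ) (w : ℝ) (p : ℤ) : Set ℝ := Icc (((p:ℝ) - w) / q) (((p:ℝ) + w) / q)

/-- union of the intervals over all reduced fractions -/
def Aset (q : ℕ) (w : ℝ) : Set ℝ := ⋃ p ∈ {p : ℤ | Int.gcd p q = 1}, Iv q w p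

lemma vol_Iv (q : ℕ) (w : ℝ) (hw : 0 ≤ w) (p : ℤ) : volume.real (Iv q w p) = 2 * w / q := by
  rw [Iv, Real.volume_real_Icc_of_le (by gcongr; linarith)]
  ring

lemma Iv_disjoint (q : ℕ) (hq : 0 < q) (w : ℝ) (hw : w ≤ 1 / 4) {p p' : ℤ} (h : p ≠ p') :
    Disjoint (Iv q w p) (Iv q w p') := by
  rw [Set.disjoint_left]
  rintro x ⟨h1, h2⟩ ⟨h3, h4⟩
  have hq' : (0:ℝ) < q := by positivity
  rw [div_le_iff₀ hq'] at h1 h3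
  rw [le_div_iff₀ hq'] at h2 h4
  rcases lt_or_gt_of_ne h with h | h
  · have : (p:ℝ) + 1 ≤ p' := by exact_mod_cast h
    linarith
  · have : (p':ℝ) + 1 ≤ p := by exact_mod_cast h
    linarith

lemma disc_upper (q : ℕ) (hq : 0 < q) (w : ℝ) (hw0 : 0 < w) (hw : w ≤ 1 / 4) (a b : ℝ) (hab : a ≤ b) :
    volume.real (Icc a b ∩ Aset q w) ≤
      (2 * w / q) * (Nat.totient q * (b - a) + (q.divisors.card + 4)) := by
  have hq' : (0:ℝ) < q := by positivity
  set u : ℤ := ⌈(q:ℝ) * a - w⌉ - 1 with hu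
  set v : ℤ := ⌊(q:ℝ) * b + w⌋ with hv
  have hqab : (q:ℝ) * a ≤ q * b := by gcongr
  have hu1 : (u:ℝ) < q * a - w := by
    have := Int.ceil_lt_add_one ((q:ℝ) * a - w)
    rw [hu]; push_cast; linarith
  have hu2 : q * a - w ≤ (u:ℝ) + 1 := by
    have := Int.le_ceil ((q:ℝ) * a - w)
    rw [hu]; push_cast; linarith
  have hv1 : (v:ℝ) ≤ q * b + w := Int.floor_le _
  have huv : u ≤ v := by
    rw [hv]; apply Int.le_floor.2; linarith
  set S := (Finset.Ioc u v).filter (fun p => Int.gcd p q = 1) with hS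
  have hsub : Icc a b ∩ Aset q w ⊆ ⋃ p ∈ S, Iv q w p := by
    rintro x ⟨⟨hx1, hx2⟩, hx⟩
    simp only [Aset, mem_iUnion] at hx ⊢
    obtain ⟨p, hp, hxp⟩ := hx
    refine ⟨p, ?_, hxp⟩
    obtain ⟨h1, h2⟩ := hxp
    rw [div_le_iff₀ hq'] at h1
    rw [le_div_iff₀ hq'] at h2
    have h3 : x * q ≤ b * q := by gcongr
    have h4 : a * q ≤ x * q := by gcongr
    simp only [hS, Finset.mem_filter, Finset.mem_Ioc]
    refine ⟨⟨?_, ?_⟩, hp⟩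
    · have : (u:ℝ) < p := by linarith
      exact_mod_cast this
    · rw [hv]; apply Int.le_floor.2; linarith
  have hcnt := (abs_le.1 (count_int q hq u v huv)).2
  have hphi : (Nat.totient q : ℝ) / q ≤ 1 := by
    rw [div_le_one hq']; exact_mod_cast Nat.totient_le q
  have hphi0 : 0 ≤ (Nat.totient q : ℝ) / q := by positivity
  have hlen : ((v:ℝ) - u) * (Nat.totient q / q) ≤ (q * (b - a) + 2) * (Nat.totient q / q) := by
    gcongr; linarith
  have heq : (q * (b - a)) * ((Nat.totient q : ℝ) / q) = Nat.totient q * (b - a) := by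
    field_simp
  have hS' : (S.card : ℝ) ≤ Nat.totient q * (b - a) + (q.divisors.card + 4) := by
    rw [add_mul, heq] at hlen
    linarith
  have hfin : volume (⋃ p ∈ S, Iv q w p) ≠ ⊤ := by
    refine ((Finset.isCompact_biUnion S (fun p _ => ?_)).measure_lt_top).ne
    exact isCompact_Icc
  calc _ ≤ volume.real (⋃ p ∈ S, Iv q w p) := measureReal_mono hsub hfin
    _ ≤ ∑ p ∈ S, volume.real (Iv q w p) := measureReal_biUnion_finset_le _ _
    _ = S.card * (2 * w / q) := by simp [vol_Iv q w hw0.le]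
    _ ≤ _ := by rw [mul_comm]; gcongr

lemma disc_lower (q : ℕ) (hq : 0 < q) (w : ℝ) (hw0 : 0 < w) (hw : w ≤ 1 / 4) (a b : ℝ) (hab : a ≤ b) :
    (2 * w / q) * (Nat.totient q * (b - a) - (q.divisors.card + 4))
      ≤ volume.real (Icc a b ∩ Aset q w) := by
  have hq' : (0:ℝ) < q := by positivity
  set u : ℤ := ⌈(q:ℝ) * a + w⌉ - 1 with hu
  set v : ℤ := ⌊(q:ℝ) * b - w⌋ with hv
  have hu1 : (u:ℝ) < q * a + w := by
    have := Int.ceil_lt_add_one ((q:ℝ) * a + w)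
    rw [hu]; push_cast; linarith
  have hv1 : (v:ℝ) ≤ q * b - w := Int.floor_le _
  have hv2 : q * b - w < (v:ℝ) + 1 := Int.lt_floor_add_one _
  have hphi : (Nat.totient q : ℝ) / q ≤ 1 := by
    rw [div_le_one hq']; exact_mod_cast Nat.totient_le q
  have hphi0 : 0 ≤ (Nat.totient q : ℝ) / q := by positivity
  have heq : (q * (b - a)) * ((Nat.totient q : ℝ) / q) = Nat.totient q * (b - a) := by
    field_simp
  have hlen : (q * (b - a) - 2) * ((Nat.totient q:ℝ) / q) ≤ ((v:ℝ) - u) * (Nat.totient q / q) := by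
    refine mul_le_mul_of_nonneg_right ?_ hphi0
    linarith
  rw [sub_mul, heq] at hlen
  have hfin : volume (Icc a b ∩ Aset q w) ≠ ⊤ :=
    ((measure_mono inter_subset_left).trans_lt isCompact_Icc.measure_lt_top).ne
  by_cases huv : u ≤ v
  swap
  · have h1 : (v:ℝ) - u ≤ 0 := by
      have : (v:ℝ) ≤ u := by exact_mod_cast (not_le.1 huv).le
      linarith
    have h2 : ((v:ℝ) - u) * (Nat.totient q / q) ≤ 0 := mul_nonpos_of_nonpos_of_nonneg h1 hphi0
    have h3 : (Nat.totient q * (b - a) - (q.divisors.card + 4) : ℝ) ≤ 0 := by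
      have : (0:ℝ) ≤ q.divisors.card := by positivity
      linarith
    exact (mul_nonpos_of_nonneg_of_nonpos (by positivity) h3).trans measureReal_nonneg
  set S := (Finset.Ioc u v).filter (fun p => Int.gcd p q = 1) with hS
  have hsub : (⋃ p ∈ S, Iv q w p) ⊆ Icc a b ∩ Aset q w := by
    intro x hx
    simp only [mem_iUnion] at hx
    obtain ⟨p, hp, hxp⟩ := hx
    simp only [hS, Finset.mem_filter, Finset.mem_Ioc] at hp
    obtain ⟨⟨hp1, hp2⟩, hp3⟩ := hp
    refine ⟨?_, ?_⟩
    · obtain ⟨h1, h2⟩ := hxp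
      rw [div_le_iff₀ hq'] at h1
      rw [le_div_iff₀ hq'] at h2
      have h3 : (q:ℝ) * a + w ≤ p := by
        apply Int.ceil_le.1
        omega
      have h4 : (p:ℝ) ≤ v := by exact_mod_cast hp2
      constructor
      · refine le_of_mul_le_mul_right ?_ hq'; linarith
      · refine le_of_mul_le_mul_right ?_ hq'; linarith
    · simp only [Aset, mem_iUnion]
      exact ⟨p, hp3, hxp⟩
  have hcnt := (abs_le.1 (count_int q hq u v huv)).1
  have hS' : Nat.totient q * (b - a) - (q.divisors.card + 4) ≤ (S.card : ℝ) := by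
    linarith
  calc _ ≤ (2 * w / q) * S.card := by gcongr
    _ = ∑ p ∈ S, volume.real (Iv q w p) := by simp [vol_Iv q w hw0.le, mul_comm]
    _ = volume.real (⋃ p ∈ S, Iv q w p) := by
        refine (measureReal_biUnion_finset ?_ ?_ ?_).symm
        · intro p _ p' _ hne
          exact Iv_disjoint q hq w hw hne
        · intro p _; exact measurableSet_Icc
        · intro p _; exact isCompact_Icc.measure_lt_top.ne
    _ ≤ _ := measureReal_mono hsub hfin

lemma arith_key (ψ : ℕ → ℝ) (hpos : ∀ q, 0 < ψ q) (L : ℝ) (hL0 : 0 ≤ L)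
    (hL : Tendsto (fun q : ℕ => -Real.log (ψ q) / Real.log q) atTop (nhds L))
    (s : ℝ) (hs0 : 0 < s) (hs : s < 1 / (L + 1)) :
    ∀ᶠ q : ℕ in atTop, (q.divisors.card : ℝ) + 4 ≤ Nat.totient q * (ψ q / q) ^ s := by
  have hs1 : s * (L + 1) < 1 := by rwa [lt_div_iff₀ (by linarith)] at hs
  set η := (1 - s * (L + 1)) / (2 * s) with hη
  have hη0 : 0 < η := by apply div_pos <;> linarith
  set θ := (1 - s * (L + 1)) / 2 with hθ
  have hθ0 : 0 < θ := by rw [hθ]; linarith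
  have hsθ : (L + η + 1) * s = 1 - θ := by
    rw [hη, hθ]; field_simp; ring
  obtain ⟨C, hC0, hC⟩ := divisor_bound (θ / 4) (by positivity)
  have h1 : ∀ᶠ q : ℕ in atTop, -Real.log (ψ q) / Real.log q < L + η :=
    hL.eventually_lt_const (by linarith)
  have h2 : ∀ᶠ q : ℕ in atTop, 5 * C ^ 2 ≤ (q:ℝ) ^ (θ / 2) :=
    ((tendsto_rpow_atTop (by positivity)).comp tendsto_natCast_atTop_atTop).eventually_ge_atTop _
  filter_upwards [h1, h2, eventually_ge_atTop 2] with q h1 h2 hq2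
  have hq2' : (2:ℝ) ≤ q := by exact_mod_cast hq2
  have hq0 : (0:ℝ) < q := by linarith
  have hlog : 0 < Real.log q := Real.log_pos (by linarith)
  rw [div_lt_iff₀ hlog] at h1
  have hψ : (q:ℝ) ^ (-(L + η)) ≤ ψ q := by
    rw [← Real.log_le_log_iff (by positivity) (hpos q), Real.log_rpow hq0]
    linarith
  have hψ2 : (q:ℝ) ^ (-(L + η + 1)) ≤ ψ q / q := by
    rw [le_div_iff₀ hq0]
    calc _ = (q:ℝ) ^ (-(L + η)) := by
          nth_rewrite 2 [← Real.rpow_one (q:ℝ)]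
          rw [← Real.rpow_add hq0]; congr 1; ring
      _ ≤ _ := hψ
  have hψ3 : (q:ℝ) ^ (-(1 - θ)) ≤ (ψ q / q) ^ s := by
    rw [← hsθ, ← neg_mul, Real.rpow_mul hq0.le]
    gcongr
  have hd := hC q (by omega)
  have hd1 : (1:ℝ) ≤ q.divisors.card := by
    have : 0 < q.divisors.card := Finset.card_pos.2 ⟨1, by simp; omega⟩
    exact_mod_cast this
  have hphi := totient_mul_divisors q (by omega)
  set d : ℝ := (q.divisors.card : ℝ)
  have hd2 : d * (d + 4) ≤ (q:ℝ) ^ θ := by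
    calc d * (d + 4) ≤ 5 * d ^ 2 := by nlinarith
      _ ≤ 5 * (C * (q:ℝ) ^ (θ / 4)) ^ 2 := by gcongr
      _ = 5 * C ^ 2 * (q:ℝ) ^ (θ / 2) := by
          rw [mul_pow, ← Real.rpow_natCast ((q:ℝ) ^ (θ/4)), ← Real.rpow_mul hq0.le]
          rw [mul_assoc]; congr 3; push_cast; ring
      _ ≤ (q:ℝ) ^ (θ / 2) * (q:ℝ) ^ (θ / 2) := by gcongr
      _ = _ := by rw [← Real.rpow_add hq0]; congr 1; ring
  have hT : 0 ≤ (ψ q / q) ^ s := by have := hpos q; positivity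
  refine le_of_mul_le_mul_left ?_ (show 0 < d by linarith)
  calc d * (d + 4) ≤ (q:ℝ) ^ θ := hd2
    _ = q * (q:ℝ) ^ (-(1 - θ)) := by
        nth_rewrite 2 [← Real.rpow_one (q:ℝ)]
        rw [← Real.rpow_add hq0]; congr 1; ring
    _ ≤ q * (ψ q / q) ^ s := by gcongr
    _ ≤ (Nat.totient q * d) * (ψ q / q) ^ s := by gcongr
    _ = _ := by ring

/-- normalising constant -/
noncomputable def cq (ψ : ℕ → ℝ) (q : ℕ) : ℝ := ψ q / q * Nat.totient q

/-- equidistribution of `A_q` relative to the set `E` -/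
def Equid (ψ : ℕ → ℝ) (E : Set ℝ) : Prop := ∀ ε > 0, ∀ᶠ q : ℕ in atTop, ∀ a b : ℝ, a ≤ b →
  |volume.real (Icc a b ∩ E ∩ Aset q (ψ q / 2)) - cq ψ q * volume.real (Icc a b ∩ E)| ≤ ε * cq ψ q

/-- The arithmetic input -/
def Arith (ψ : ℕ → ℝ) (s : ℝ) : Prop :=
  ∀ᶠ q : ℕ in atTop, (q.divisors.card : ℝ) + 4 ≤ Nat.totient q * (ψ q / q) ^ s

lemma cq_pos (ψ : ℕ → ℝ) (hpos : ∀ q, 0 < ψ q) (q : ℕ) (hq : 0 < q) : 0 < cq ψ q := by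
  have h1 := hpos q
  have h2 : 0 < Nat.totient q := Nat.totient_pos.2 hq
  unfold cq
  positivity

lemma disc_all (ψ : ℕ → ℝ) (hpos : ∀ q, 0 < ψ q) (hlt : ∀ q, ψ q < 1 / 2) (s : ℝ)
    (h : Arith ψ s) : ∀ᶠ q : ℕ in atTop, ∀ a b : ℝ, a ≤ b →
    |volume.real (Icc a b ∩ Aset q (ψ q / 2)) - cq ψ q * (b - a)| ≤ (ψ q / q) ^ s * cq ψ q := by
  filter_upwards [h, eventually_gt_atTop 0] with q h hq a b hab
  have h1 := disc_upper q hq (ψ q / 2) (by linarith [hpos q]) (by linarith [hlt q]) a b hab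
  have h2 := disc_lower q hq (ψ q / 2) (by linarith [hpos q]) (by linarith [hlt q]) a b hab
  have e : 2 * (ψ q / 2) / q = ψ q / q := by ring
  rw [e] at h1 h2
  have h0 : 0 ≤ ψ q / q := by have := hpos q; positivity
  have h3 := mul_le_mul_of_nonneg_left h h0
  rw [abs_le]
  unfold cq
  constructor <;> nlinarith

lemma equid_unit (ψ : ℕ → ℝ) (hpos : ∀ q, 0 < ψ q) (hlt : ∀ q, ψ q < 1 / 2) (s : ℝ) (hs : 0 < s)
    (h : Arith ψ s) : Equid ψ (Icc 0 1) := by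
  intro ε hε
  have ht : Tendsto (fun q : ℕ => ((q:ℝ)⁻¹) ^ s) atTop (nhds 0) := by
    have := (tendsto_inv_atTop_nhds_zero_nat (𝕜 := ℝ)).rpow_const (p := s) (Or.inr hs.le)
    rwa [Real.zero_rpow hs.ne'] at this
  filter_upwards [disc_all ψ hpos hlt s h, ht.eventually_lt_const hε, eventually_gt_atTop 0]
    with q hd hε' hq a b hab
  have hc := cq_pos ψ hpos q hq
  rw [Icc_inter_Icc]
  by_cases hle : max a 0 ≤ min b 1
  · rw [Real.volume_real_Icc_of_le hle]
    refine (hd _ _ hle).trans ?_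
    gcongr
    refine le_trans ?_ hε'.le
    have := hpos q
    rw [inv_eq_one_div]
    gcongr
    linarith [hlt q]
  · have : Icc (max a 0) (min b 1) = ∅ := Icc_eq_empty hle
    change |volume.real (Icc (max a 0) (min b 1) ∩ _) - _ * volume.real (Icc (max a 0) (min b 1))| ≤ _
    rw [this]
    simp
    positivity

lemma ball_bound (ψ : ℕ → ℝ) (hpos : ∀ q, 0 < ψ q) (hlt : ∀ q, ψ q < 1 / 2) (s : ℝ) (hs : 0 < s)
    (hs1 : s ≤ 1) (h : Arith ψ s) : ∀ᶠ q : ℕ in atTop, ∀ a b : ℝ, a ≤ b → b ≤ a + 1 →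
    volume.real (Icc a b ∩ Aset q (ψ q / 2)) ≤ 2 * cq ψ q * (b - a) ^ s := by
  filter_upwards [disc_all ψ hpos hlt s h, h, eventually_gt_atTop 0] with q hd ha hq a b hab hb1
  have hc := cq_pos ψ hpos q hq
  have hu := (abs_le.1 (hd a b hab)).2
  set l := b - a with hl
  have hl0 : 0 ≤ l := by linarith
  have hl1 : l ≤ 1 := by linarith
  have hr : 0 < ψ q / q := by have := hpos q; positivity
  by_cases hlr : ψ q / q ≤ l
  · have h1 : (ψ q / q) ^ s ≤ l ^ s := by gcongr
    have h2 : l ≤ l ^ s := by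
      have := Real.rpow_le_rpow_of_exponent_ge' hl0 hl1 hs.le hs1
      rwa [Real.rpow_one] at this
    have h3 := mul_le_mul_of_nonneg_left h1 hc.le
    have h4 := mul_le_mul_of_nonneg_left h2 hc.le
    nlinarith
  · push Not at hlr
    have hv : volume.real (Icc a b ∩ Aset q (ψ q / 2)) ≤ l := by
      rw [hl, ← Real.volume_real_Icc_of_le hab]
      exact measureReal_mono inter_subset_left isCompact_Icc.measure_lt_top.ne
    refine hv.trans ?_
    have hd0 : (0:ℝ) ≤ q.divisors.card := by positivity
    have hone : 1 ≤ (Nat.totient q : ℝ) * (ψ q / q) ^ s := by linarith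
    calc l = l ^ (1 - s) * l ^ s := by
          rcases hl0.eq_or_lt with h0 | h0
          · rw [← h0, Real.zero_rpow hs.ne']; simp
          · rw [← Real.rpow_add h0]; simp
      _ ≤ (ψ q / q) ^ (1 - s) * l ^ s := by
          gcongr
      _ ≤ ((ψ q / q) ^ (1 - s) * ((Nat.totient q : ℝ) * (ψ q / q) ^ s)) * l ^ s := by
          gcongr
          exact le_mul_of_one_le_right (by positivity) hone
      _ = cq ψ q * l ^ s := by
          have : (ψ q / q) ^ (1 - s) * (ψ q / q) ^ s = ψ q / q := by
            rw [← Real.rpow_add hr]; simp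
          unfold cq
          nth_rewrite 3 [← this]
          ring
      _ ≤ _ := by
          have : 0 ≤ cq ψ q * l ^ s := by positivity
          linarith

lemma inter_Aset (q : ℕ) (hq : 0 < q) (w : ℝ) (hw : w ≤ 1 / 4) (E : Set ℝ)
    (hE : E ⊆ Icc 0 1) : ∃ S : Finset ℤ, E ∩ Aset q w = ⋃ p ∈ S, (Iv q w p ∩ E) := by
  refine ⟨(Finset.Icc (-1) ((q:ℤ) + 1)).filter (fun p => Int.gcd p q = 1), ?_⟩
  have hq' : (0:ℝ) < q := by positivity
  ext x
  simp only [Aset, mem_inter_iff, mem_iUnion, Finset.mem_filter, Finset.mem_Icc, mem_ofPred_eq, exists_prop]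
  constructor
  · rintro ⟨hx, p, hp, hxp⟩
    refine ⟨p, ⟨⟨?_, ?_⟩, hp⟩, hxp, hx⟩
    · obtain ⟨h1, h2⟩ := hxp
      rw [le_div_iff₀ hq'] at h2
      have : 0 ≤ x * q := mul_nonneg (hE hx).1 hq'.le
      have : (-1:ℝ) ≤ p := by linarith
      exact_mod_cast this
    · obtain ⟨h1, h2⟩ := hxp
      rw [div_le_iff₀ hq'] at h1
      have : x * q ≤ 1 * q := by gcongr; exact (hE hx).2
      have : (p:ℝ) ≤ q + 1 := by linarith
      exact_mod_cast this
  · rintro ⟨p, ⟨_, hp⟩, hxp, hx⟩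
    exact ⟨hx, p, hp, hxp⟩

lemma measurable_Aset (q : ℕ) (w : ℝ) : MeasurableSet (Aset q w) := by
  unfold Aset
  refine MeasurableSet.biUnion (to_countable _) fun p _ => measurableSet_Icc

lemma equid_inter (ψ : ℕ → ℝ) (hpos : ∀ q, 0 < ψ q) (hlt : ∀ q, ψ q < 1 / 2)
    (E : Set ℝ) (hE : E ⊆ Icc 0 1) (hm : MeasurableSet E) (hP : Equid ψ E) (q' : ℕ) (hq' : 0 < q') :
    Equid ψ (E ∩ Aset q' (ψ q' / 2)) := by
  have hw : ψ q' / 2 ≤ 1 / 4 := by linarith [hlt q']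
  obtain ⟨S, hS⟩ := inter_Aset q' hq' (ψ q' / 2) hw E hE
  intro ε hε
  have hε' : 0 < ε / (S.card + 1) := by positivity
  filter_upwards [hP _ hε', eventually_gt_atTop 0] with q hq hq0 a b hab
  have hc := cq_pos ψ hpos q hq0
  have key : ∀ p ∈ S, |volume.real (Icc a b ∩ (Iv q' (ψ q' / 2) p ∩ E) ∩ Aset q (ψ q / 2))
      - cq ψ q * volume.real (Icc a b ∩ (Iv q' (ψ q' / 2) p ∩ E))| ≤ ε / (S.card + 1) * cq ψ q := by
    intro p _
    rw [← inter_assoc, Iv, Icc_inter_Icc]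
    by_cases hle : max a ((↑p - ψ q' / 2) / ↑q') ≤ min b ((↑p + ψ q' / 2) / ↑q')
    · exact hq _ _ hle
    · have : Icc (max a ((↑p - ψ q' / 2) / ↑q')) (min b ((↑p + ψ q' / 2) / ↑q')) = ∅ := Icc_eq_empty hle
      change |volume.real (Icc (max a ((↑p - ψ q' / 2) / ↑q')) (min b ((↑p + ψ q' / 2) / ↑q')) ∩ _ ∩ _)
        - _ * volume.real (Icc (max a ((↑p - ψ q' / 2) / ↑q')) (min b ((↑p + ψ q' / 2) / ↑q')) ∩ _)| ≤ _
      rw [this]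
      simp
      positivity
  have hdis : ∀ F : Set ℝ, (S : Set ℤ).PairwiseDisjoint (fun p => Iv q' (ψ q' / 2) p ∩ F) := by
    intro F p _ p' _ hne
    exact (Iv_disjoint q' hq' _ hw hne).mono inter_subset_left inter_subset_left
  have hfin : ∀ F : Set ℝ, ∀ p : ℤ, volume (Iv q' (ψ q' / 2) p ∩ F) ≠ ⊤ := by
    intro F p
    exact ((measure_mono inter_subset_left).trans_lt isCompact_Icc.measure_lt_top).ne
  have e1 : volume.real (Icc a b ∩ (E ∩ Aset q' (ψ q' / 2)))
      = ∑ p ∈ S, volume.real (Icc a b ∩ (Iv q' (ψ q' / 2) p ∩ E)) := by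
    have : Icc a b ∩ (E ∩ Aset q' (ψ q' / 2)) = ⋃ p ∈ S, (Iv q' (ψ q' / 2) p ∩ (Icc a b ∩ E)) := by
      rw [hS]; ext x; simp; tauto
    rw [this, measureReal_biUnion_finset (hdis _) (fun p _ => measurableSet_Icc.inter (measurableSet_Icc.inter hm))
      (fun p _ => hfin _ p)]
    refine Finset.sum_congr rfl fun p _ => ?_
    rw [inter_left_comm]
  have e2 : volume.real (Icc a b ∩ (E ∩ Aset q' (ψ q' / 2)) ∩ Aset q (ψ q / 2))
      = ∑ p ∈ S, volume.real (Icc a b ∩ (Iv q' (ψ q' / 2) p ∩ E) ∩ Aset q (ψ q / 2)) := by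
    have : Icc a b ∩ (E ∩ Aset q' (ψ q' / 2)) ∩ Aset q (ψ q / 2) =
        ⋃ p ∈ S, (Iv q' (ψ q' / 2) p ∩ (Icc a b ∩ E ∩ Aset q (ψ q / 2))) := by
      rw [hS]; ext x; simp; tauto
    rw [this, measureReal_biUnion_finset (hdis _) (fun p _ => measurableSet_Icc.inter
      ((measurableSet_Icc.inter hm).inter (measurable_Aset _ _))) (fun p _ => hfin _ p)]
    refine Finset.sum_congr rfl fun p _ => ?_
    congr 1; ext x; simp; tauto
  rw [e1, e2, Finset.mul_sum, ← Finset.sum_sub_distrib]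
  refine (Finset.abs_sum_le_sum_abs _ _).trans ((Finset.sum_le_sum key).trans ?_)
  rw [Finset.sum_const, nsmul_eq_mul, ← mul_assoc]
  gcongr
  rw [mul_div_assoc', div_le_iff₀ (by positivity)]
  nlinarith

/-- Good sets of the construction -/
def Good (ψ : ℕ → ℝ) (s : ℝ) (E : Set ℝ) : Prop :=
  IsCompact E ∧ E ⊆ Icc 0 1 ∧ Equid ψ E ∧ ∃ C > 0, C / 2 < volume.real E ∧
    ∃ B < 2, ∀ a b : ℝ, a ≤ b → b ≤ a + 1 → volume.real (Icc a b ∩ E) ≤ B * C * (b - a) ^ s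

lemma good_unit (ψ : ℕ → ℝ) (s : ℝ) (hs0 : 0 < s) (hs1 : s ≤ 1) (h : Equid ψ (Icc 0 1)) :
    Good ψ s (Icc 0 1) := by
  refine ⟨isCompact_Icc, subset_rfl, h, 1, one_pos, by simp; norm_num, 1, by norm_num, ?_⟩
  intro a b hab hb
  have h2 : b - a ≤ (b - a) ^ s := by
    have := Real.rpow_le_rpow_of_exponent_ge' (x := b - a) (by linarith) (by linarith) hs0.le hs1
    rwa [Real.rpow_one] at this
  have : volume.real (Icc a b ∩ Icc 0 1) ≤ volume.real (Icc a b) :=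
    measureReal_mono inter_subset_left isCompact_Icc.measure_lt_top.ne
  rw [Real.volume_real_Icc_of_le hab] at this
  linarith

lemma good_step (ψ : ℕ → ℝ) (hpos : ∀ q, 0 < ψ q) (hlt : ∀ q, ψ q < 1 / 2) (s s' : ℝ) (hs : 0 < s)
    (hss : s < s') (hs1 : s' ≤ 1) (h : Arith ψ s') (E : Set ℝ) (hE : Good ψ s E) :
    ∀ᶠ q : ℕ in atTop, Good ψ s (E ∩ Aset q (ψ q / 2)) := by
  obtain ⟨hcomp, hsub, hP, C, hC, hmass, B, hB, hbd⟩ := hE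
  set B1 := max B 1 with hB1
  have hB1' : B1 < 2 := max_lt hB (by norm_num)
  have hB1'' : 1 ≤ B1 := le_max_right _ _
  have hBB : B ≤ B1 := le_max_left _ _
  set δ : ℝ := (C / 2) ^ (1 / (s' - s)) with hδ
  have hδ0 : 0 < δ := by positivity
  have hδ1 : δ ^ (s' - s) = C / 2 := by
    rw [hδ, ← Real.rpow_mul (by positivity), one_div, inv_mul_cancel₀ (by linarith), Real.rpow_one]
  set ε := min ((volume.real E - C / 2) / 2) ((2 - B1) / 2 * C * δ ^ s) with hε
  have hε0 : 0 < ε := by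
    refine lt_min (by linarith) ?_
    have : 0 < 2 - B1 := by linarith
    positivity
  have hε1 : ε ≤ (volume.real E - C / 2) / 2 := min_le_left _ _
  have hε2 : ε ≤ (2 - B1) / 2 * C * δ ^ s := min_le_right _ _
  filter_upwards [hP ε hε0, ball_bound ψ hpos hlt s' (by linarith) hs1 h, eventually_gt_atTop 0]
    with q hq hball hq0
  have hc := cq_pos ψ hpos q hq0
  have hEfin : volume E ≠ ⊤ := hcomp.measure_lt_top.ne
  refine ⟨?_, inter_subset_left.trans hsub, equid_inter ψ hpos hlt E hsub hcomp.measurableSet hP q hq0,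
    cq ψ q * C, by positivity, ?_, (B1 + 2) / 2, by linarith, ?_⟩
  · obtain ⟨S, hS⟩ := inter_Aset q hq0 (ψ q / 2) (by linarith [hlt q]) E hsub
    rw [hS]
    exact Finset.isCompact_biUnion S (fun p _ => isCompact_Icc.inter hcomp)
  · have h1 := (abs_le.1 (hq 0 1 zero_le_one)).1
    rw [inter_eq_right.2 hsub] at h1
    have : ε * cq ψ q < (volume.real E - C / 2) * cq ψ q := by gcongr; linarith
    nlinarith
  · intro a b hab hb
    have hl0 : 0 ≤ b - a := by linarith
    by_cases hl : b - a < δ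
    · have h1 : volume.real (Icc a b ∩ (E ∩ Aset q (ψ q / 2))) ≤ volume.real (Icc a b ∩ Aset q (ψ q / 2)) := by
        refine measureReal_mono (inter_subset_inter_right _ inter_subset_right) ?_
        exact ((measure_mono inter_subset_left).trans_lt isCompact_Icc.measure_lt_top).ne
      have h2 : (b - a) ^ s' ≤ C / 2 * (b - a) ^ s := by
        rw [← hδ1]
        calc (b - a) ^ s' = (b - a) ^ (s' - s) * (b - a) ^ s := by
              rcases hl0.eq_or_lt with h0 | h0
              · rw [← h0, Real.zero_rpow hs.ne', Real.zero_rpow (by linarith)]; simp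
              · rw [← Real.rpow_add h0]; simp
          _ ≤ _ := by
              have : 0 ≤ s' - s := by linarith
              gcongr
      calc _ ≤ 2 * cq ψ q * (b - a) ^ s' := h1.trans (hball a b hab hb)
        _ ≤ 2 * cq ψ q * (C / 2 * (b - a) ^ s) := by gcongr
        _ = 1 * (cq ψ q * C) * (b - a) ^ s := by ring
        _ ≤ _ := by gcongr; linarith
    · push Not at hl
      have h1 := (abs_le.1 (hq a b hab)).2
      rw [inter_assoc] at h1
      have h2 := hbd a b hab hb
      have h3 : δ ^ s ≤ (b - a) ^ s := by gcongr
      have h4 : B * C * (b - a) ^ s ≤ B1 * C * (b - a) ^ s := by gcongr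
      have h5 : (2 - B1) / 2 * C * δ ^ s ≤ (2 - B1) / 2 * C * (b - a) ^ s := by
        have : 0 < 2 - B1 := by linarith
        gcongr
      calc _ ≤ cq ψ q * (volume.real (Icc a b ∩ E) + ε) := by linarith
        _ ≤ cq ψ q * ((B1 + 2) / 2 * C * (b - a) ^ s) := by
            gcongr
            nlinarith
        _ = _ := by ring

lemma haus_pos (ψ : ℕ → ℝ) (s : ℝ) (hs : 0 < s) (hs1 : s ≤ 1) (E : ℕ → Set ℝ) (hanti : Antitone E)
    (hE : ∀ k, Good ψ s (E k)) : μH[s] (⋂ k, E k) ≠ 0 := by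
  intro h0
  rw [Measure.hausdorffMeasure_apply] at h0
  have h1 : (⨅ (t : ℕ → Set ℝ) (_ : (⋂ k, E k) ⊆ ⋃ n, t n) (_ : ∀ n, Metric.ediam (t n) ≤ ENNReal.ofReal (1/4)),
          ∑' n, ⨆ _ : (t n).Nonempty, Metric.ediam (t n) ^ s) ≤ 0 := by
    rw [← h0]
    exact le_iSup₂_of_le (ENNReal.ofReal (1/4)) (by simp) le_rfl
  have h2 := h1.trans_lt (show (0:ENNReal) < ENNReal.ofReal (1/16) by simp)
  simp only [iInf_lt_iff] at h2
  obtain ⟨t, htc, htd, hsum⟩ := h2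
  set D : ℕ → ℝ := fun n => (Metric.ediam (t n)).toReal with hD
  have hfin : ∀ n, Metric.ediam (t n) ≠ ⊤ := fun n => ((htd n).trans_lt ENNReal.ofReal_lt_top).ne
  have hD0 : ∀ n, 0 ≤ D n := fun n => ENNReal.toReal_nonneg
  have hD1 : ∀ n, D n ≤ 1 / 4 := fun n => by
    have := ENNReal.toReal_mono ENNReal.ofReal_ne_top (htd n)
    rwa [ENNReal.toReal_ofReal (by norm_num)] at this
  have hterm : ∀ n, ENNReal.ofReal (D n ^ s) ≤ ⨆ _ : (t n).Nonempty, Metric.ediam (t n) ^ s := by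
    intro n
    rcases (t n).eq_empty_or_nonempty with hne | hne
    · have : D n = 0 := by simp [hD, hne]
      rw [this, Real.zero_rpow hs.ne']; simp
    · simp only [hne, iSup_pos]
      rw [← ENNReal.ofReal_rpow_of_nonneg (hD0 n) hs.le, ENNReal.ofReal_toReal (hfin n)]
  have hDsum : ∀ F : Finset ℕ, ∑ n ∈ F, D n ^ s ≤ 1 / 16 := by
    intro F
    have : ENNReal.ofReal (∑ n ∈ F, D n ^ s) ≤ ENNReal.ofReal (1/16) := by
      rw [ENNReal.ofReal_sum_of_nonneg (fun n _ => by have := hD0 n; positivity)]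
      exact (Finset.sum_le_sum fun n _ => hterm n).trans ((ENNReal.sum_le_tsum F).trans hsum.le)
    exact (ENNReal.ofReal_le_ofReal_iff (by norm_num)).1 this
  -- enlargement
  have htau : ∀ n, ∃ τ : ℝ, 0 < τ ∧ τ ≤ 1 / 4 ∧ (2 * (D n + τ)) ^ s ≤ 2 * D n ^ s + 1 / 16 * (1 / 2) ^ n := by
    intro n
    have hcont : Tendsto (fun τ : ℝ => (2 * (D n + τ)) ^ s) (nhdsWithin 0 (Ioi 0)) (nhds ((2 * (D n + 0)) ^ s)) := by
      apply Tendsto.mono_left _ nhdsWithin_le_nhds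
      have : Continuous (fun τ : ℝ => (2 * (D n + τ)) ^ s) :=
        Continuous.rpow_const (by fun_prop) (fun _ => Or.inr hs.le)
      exact this.tendsto 0
    have hlt : (2 * (D n + 0)) ^ s < 2 * D n ^ s + 1 / 16 * (1 / 2) ^ n := by
      rw [add_zero, Real.mul_rpow (by norm_num) (hD0 n)]
      have a1 : (2:ℝ) ^ s ≤ 2 := by
        have := Real.rpow_le_rpow_of_exponent_le (x := 2) (by norm_num) hs1
        rwa [Real.rpow_one] at this
      have a2 : 0 ≤ D n ^ s := by have := hD0 n; positivity
      have a3 : (0:ℝ) < 1 / 16 * (1 / 2) ^ n := by positivity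
      nlinarith
    have e1 := hcont.eventually_lt_const hlt
    have e2 : ∀ᶠ τ : ℝ in nhdsWithin 0 (Ioi 0), τ ∈ Ioc (0:ℝ) (1/4) := Ioc_mem_nhdsGT (by norm_num)
    obtain ⟨τ, h1, h2⟩ := (e1.and e2).exists
    exact ⟨τ, h2.1, h2.2, h1.le⟩
  choose τ hτ0 hτ1 hτ using htau
  have hx : ∀ n, ∃ x : ℝ, t n ⊆ Ioo (x - (D n + τ n)) (x + (D n + τ n)) := by
    intro n
    rcases (t n).eq_empty_or_nonempty with hne | ⟨x, hx⟩
    · exact ⟨0, by simp [hne]⟩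
    · refine ⟨x, fun y hy => ?_⟩
      have h1 : edist y x ≤ Metric.ediam (t n) := Metric.edist_le_ediam_of_mem hy hx
      have h2 : dist y x ≤ D n := by
        rw [dist_edist]
        exact ENNReal.toReal_mono (hfin n) h1
      rw [Real.dist_eq, abs_le] at h2
      have := hτ0 n
      constructor <;> linarith
  choose x hx using hx
  set U : ℕ → Set ℝ := fun n => Ioo (x n - (D n + τ n)) (x n + (D n + τ n)) with hU
  obtain ⟨k, hk⟩ : ∃ k, E k ⊆ ⋃ n, U n := by
    refine exists_subset_nhds_of_isCompact (directed_of_isDirected_le hanti) (fun k => (hE k).1) ?_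
    intro y hy
    refine (isOpen_iUnion fun n => isOpen_Ioo).mem_nhds ?_
    obtain ⟨n, hn⟩ := mem_iUnion.1 (htc hy)
    exact mem_iUnion.2 ⟨n, hx n hn⟩
  obtain ⟨F, hF⟩ := (hE k).1.elim_finite_subcover U (fun n => isOpen_Ioo) hk
  obtain ⟨hcomp, -, -, C, hC, hmass, B, hB, hbd⟩ := hE k
  have hsub : E k ⊆ ⋃ n ∈ F, (Icc (x n - (D n + τ n)) (x n + (D n + τ n)) ∩ E k) := by
    intro y hy
    obtain ⟨n, hn, hyn⟩ := mem_iUnion₂.1 (hF hy)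
    exact mem_iUnion₂.2 ⟨n, hn, Ioo_subset_Icc_self hyn, hy⟩
  have hfin2 : volume (⋃ n ∈ F, (Icc (x n - (D n + τ n)) (x n + (D n + τ n)) ∩ E k)) ≠ ⊤ :=
    (Finset.isCompact_biUnion F (fun n _ => isCompact_Icc.inter hcomp)).measure_lt_top.ne
  have hgeo : ∑ n ∈ F, ((1:ℝ) / 2) ^ n ≤ 2 := by
    refine (summable_geometric_two.sum_le_tsum F (fun n _ => by positivity)).trans ?_
    exact tsum_geometric_two.le
  have hfinal : volume.real (E k) ≤ 2 * C * (1 / 4) := by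
    calc volume.real (E k) ≤ _ := measureReal_mono hsub hfin2
      _ ≤ ∑ n ∈ F, volume.real (Icc (x n - (D n + τ n)) (x n + (D n + τ n)) ∩ E k) :=
          measureReal_biUnion_finset_le _ _
      _ ≤ ∑ n ∈ F, 2 * C * (2 * D n ^ s + 1 / 16 * (1 / 2) ^ n) := by
          refine Finset.sum_le_sum fun n _ => ?_
          have g1 := hD0 n
          have g2 := hD1 n
          have g3 := hτ0 n
          have g4 := hτ1 n
          have g5 := hbd (x n - (D n + τ n)) (x n + (D n + τ n)) (by linarith) (by linarith)
          have g6 : x n + (D n + τ n) - (x n - (D n + τ n)) = 2 * (D n + τ n) := by ring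
          rw [g6] at g5
          have g7 : 0 ≤ (2 * (D n + τ n)) ^ s := by positivity
          calc _ ≤ B * C * (2 * (D n + τ n)) ^ s := g5
            _ ≤ 2 * C * (2 * (D n + τ n)) ^ s := by gcongr
            _ ≤ _ := by gcongr; exact hτ n
      _ = 2 * C * (2 * ∑ n ∈ F, D n ^ s + 1 / 16 * ∑ n ∈ F, ((1:ℝ) / 2) ^ n) := by
          rw [← Finset.mul_sum, Finset.sum_add_distrib, ← Finset.mul_sum, ← Finset.mul_sum]
      _ ≤ 2 * C * (1 / 4) := by
          have := hDsum F
          gcongr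
          linarith
  linarith

theorem WstarQ_dimH_ge (ψ : ℕ → ℝ) (hψ : ∀ q, ψ q ∈ Set.Ico (0 : ℝ) (1 / 2))
    (hpos : ∀ q, 0 < ψ q) (L : ℝ)
    (hL : Tendsto (fun q : ℕ => -Real.log (ψ q) / Real.log q) atTop (nhds L))
    (Q : Set ℕ) (hQ : Q.Infinite) :
    ENNReal.ofReal (1 / (L + 1)) ≤
      dimH {x : ℝ | x ∈ Set.Icc (0 : ℝ) 1 ∧
        {q : ℕ | q ∈ Q ∧ ∃ p : ℤ, Int.gcd p q = 1 ∧ |q * x - p| < ψ q}.Infinite} := by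
  have hlt : ∀ q, ψ q < 1 / 2 := fun q => (hψ q).2
  have hL0 : 0 ≤ L := by
    refine ge_of_tendsto' hL fun q => ?_
    refine div_nonneg ?_ (Real.log_natCast_nonneg q)
    have := Real.log_nonpos (hpos q).le (by linarith [hlt q])
    linarith
  have hle1 : 1 / (L + 1) ≤ 1 := by rw [div_le_one (by linarith)]; linarith
  have main : ∀ s : ℝ, 0 < s → s < 1 / (L + 1) → ENNReal.ofReal s ≤
      dimH {x : ℝ | x ∈ Set.Icc (0 : ℝ) 1 ∧
        {q : ℕ | q ∈ Q ∧ ∃ p : ℤ, Int.gcd p q = 1 ∧ |q * x - p| < ψ q}.Infinite} := by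
    intro s hs0 hs
    obtain ⟨s', hss', hs'⟩ := exists_between hs
    have hA : Arith ψ s' := arith_key ψ hpos L hL0 hL s' (by linarith) hs'
    have step : ∀ (E : {E : Set ℝ // Good ψ s E}) (m : ℕ), ∃ q : ℕ, m < q ∧ q ∈ Q ∧
        Good ψ s (E.1 ∩ Aset q (ψ q / 2)) := by
      intro E m
      have e1 := good_step ψ hpos hlt s s' hs0 hss' (by linarith) hA E.1 E.2
      have e2 : ∃ᶠ q in atTop, q ∈ Q := Nat.frequently_atTop_iff_infinite.2 hQ
      obtain ⟨q, h1, h2, h3⟩ := (e2.and_eventually (e1.and (eventually_gt_atTop m))).exists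
      exact ⟨q, h3, h1, h2⟩
    choose nxt hn1 hn2 hn3 using step
    let st : ℕ → {E : Set ℝ // Good ψ s E} × ℕ := fun n => Nat.rec
      (⟨Icc 0 1, good_unit ψ s hs0 (by linarith) (equid_unit ψ hpos hlt s' (by linarith) hA)⟩, 0)
      (fun _ p => (⟨p.1.1 ∩ Aset (nxt p.1 p.2) (ψ (nxt p.1 p.2) / 2), hn3 p.1 p.2⟩, nxt p.1 p.2)) n
    let qs : ℕ → ℕ := fun n => nxt (st n).1 (st n).2
    have hq : ∀ n, (st (n+1)).2 = qs n := fun n => rfl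
    have hEs : ∀ n, (st (n+1)).1.1 = (st n).1.1 ∩ Aset (qs n) (ψ (qs n) / 2) := fun n => rfl
    have hmono : StrictMono qs := strictMono_nat_of_lt_succ fun n => by
      have := hn1 (st (n+1)).1 (st (n+1)).2
      rwa [hq n] at this
    have hqpos : ∀ n, 0 < qs n := fun n => (Nat.zero_le _).trans_lt (hn1 _ _)
    have hanti : Antitone (fun n => (st n).1.1) := antitone_nat_of_succ_le fun n => by
      rw [hEs n]; exact inter_subset_left
    have hne := haus_pos ψ s hs0 (by linarith) (fun n => (st n).1.1) hanti (fun n => (st n).1.2)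
    have hd : ENNReal.ofReal s ≤ dimH (⋂ n, (st n).1.1) := by
      have : μH[((s.toNNReal : NNReal) : ℝ)] (⋂ n, (st n).1.1) ≠ 0 := by
        rwa [Real.coe_toNNReal s hs0.le]
      exact le_dimH_of_hausdorffMeasure_ne_zero this
    refine hd.trans (dimH_mono ?_)
    intro y hy
    have hy' : ∀ n, y ∈ (st n).1.1 := fun n => mem_iInter.1 hy n
    refine ⟨hy' 0, ?_⟩
    refine (Set.infinite_range_of_injective hmono.injective).mono ?_
    rintro _ ⟨n, rfl⟩
    refine ⟨hn2 _ _, ?_⟩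
    have h1 := hy' (n+1)
    rw [hEs n] at h1
    have h2 := h1.2
    simp only [Aset, mem_iUnion] at h2
    obtain ⟨p, hp, h3, h4⟩ := h2
    have hq' : (0:ℝ) < qs n := by exact_mod_cast hqpos n
    rw [div_le_iff₀ hq'] at h3
    rw [le_div_iff₀ hq'] at h4
    refine ⟨p, hp, ?_⟩
    have := hpos (qs n)
    rw [abs_lt]
    constructor <;> linarith
  refine le_of_forall_lt fun c hc => ?_
  obtain ⟨s, hs1, hs2⟩ := exists_between hc
  have hsfin : s ≠ ⊤ := (hs2.trans ENNReal.ofReal_lt_top).ne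
  have hs0 : 0 < s.toReal := ENNReal.toReal_pos ((zero_le).trans_lt hs1).ne' hsfin
  have hs3 : s.toReal < 1 / (L + 1) := by
    rw [ENNReal.lt_ofReal_iff_toReal_lt hsfin] at hs2
    exact hs2
  have := main s.toReal hs0 hs3
  rw [ENNReal.ofReal_toReal hsfin] at this
  exact hs1.trans_le this
end

section
/- Let ψ: ℕ → [0,1/2) be a function and let s ∈ (0,1). If the series ∑_{q=1}^∞ (ψ(q)/q)^s · φ(q) diverges, then the s-dimensional Hausdorff measure of the set W*(1,ψ) := {x ∈ [0,1] : for infinitely many q ∈ ℕ there exists an integer p with gcd(p,q) = 1 and |qx − p| < ψ(q)} is infinite; in particular dim_H W*(1,ψ) ≥ s. -/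
open Set Filter MeasureTheory

/-- residues coprime to `q` -/
def cop (q : ℕ) : Finset ℕ := (Finset.range q).filter (fun a => q.Coprime a)

lemma card_cop (q : ℕ) : (cop q).card = q.totient := rfl

lemma tot_lower (ε : ℝ) (hε : 0 < ε) :
    ∃ C : ℝ, 1 ≤ C ∧ ∀ n : ℕ, 1 ≤ n → (n : ℝ) ≤ C * (n : ℝ) ^ ε * (n.totient : ℝ) := by
  obtain ⟨P, hP⟩ := exists_nat_gt ((2 : ℝ) ^ (1 / ε))
  refine ⟨2 ^ P, one_le_pow₀ (by norm_num), fun n hn => ?_⟩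
  have h1 := Nat.totient_mul_prod_primeFactors n
  have h1' : (n.totient : ℝ) * ∏ p ∈ n.primeFactors, (p : ℝ)
      = n * ∏ p ∈ n.primeFactors, ((p : ℝ) - 1) := by
    have := congrArg (fun k : ℕ => (k : ℝ)) h1
    simp only [Nat.cast_mul, Nat.cast_prod] at this
    rw [this]
    congr 1
    refine Finset.prod_congr rfl fun p hp => ?_
    have := (Nat.prime_of_mem_primeFactors hp).one_lt
    rw [Nat.cast_sub (by omega)]; simp
  have hterm : ∀ p ∈ n.primeFactors, (p : ℝ) ≤
      ((if p < P then (2 : ℝ) else 1) * (p : ℝ) ^ ε) * ((p : ℝ) - 1) := by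
    intro p hp
    have h2 : (2 : ℝ) ≤ p := by exact_mod_cast (Nat.prime_of_mem_primeFactors hp).two_le
    have h3 : (1 : ℝ) ≤ (p : ℝ) ^ ε := Real.one_le_rpow (by linarith) hε.le
    split_ifs with h
    · nlinarith
    · have h4 : (2 : ℝ) ≤ (p : ℝ) ^ ε := by
        have h5 : (2 : ℝ) ^ (1 / ε) ≤ p := hP.le.trans (by exact_mod_cast not_lt.mp h)
        calc (2 : ℝ) = ((2 : ℝ) ^ (1 / ε)) ^ ε := by
              rw [← Real.rpow_mul (by norm_num)]; field_simp; simp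
          _ ≤ _ := Real.rpow_le_rpow (by positivity) h5 hε.le
      nlinarith
  have hprod : ∏ p ∈ n.primeFactors, (p : ℝ) ≤
      (2 ^ P * (n : ℝ) ^ ε) * ∏ p ∈ n.primeFactors, ((p : ℝ) - 1) := by
    have hpos : ∀ p ∈ n.primeFactors, (0 : ℝ) ≤ (p : ℝ) - 1 := by
      intro p hp
      have h2 : (2 : ℝ) ≤ p := by exact_mod_cast (Nat.prime_of_mem_primeFactors hp).two_le
      linarith
    refine (Finset.prod_le_prod (fun p _ => by positivity) hterm).trans ?_
    rw [Finset.prod_mul_distrib, Finset.prod_mul_distrib]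
    refine mul_le_mul_of_nonneg_right ?_ (Finset.prod_nonneg hpos)
    refine mul_le_mul ?_ ?_ (Finset.prod_nonneg fun p _ => by positivity) (by positivity)
    · rw [← Finset.prod_filter, Finset.prod_const]
      refine pow_le_pow_right₀ (by norm_num) ?_
      refine (Finset.card_le_card (t := Finset.range P) ?_).trans (by simp)
      intro p hp; simp at hp ⊢; exact hp.2
    · rw [Real.finsetProd_rpow _ _ (fun p _ => by positivity)]
      refine Real.rpow_le_rpow (Finset.prod_nonneg fun p _ => by positivity) ?_ hε.le
      have := Nat.le_of_dvd (by omega) (Nat.prod_primeFactors_dvd n)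
      have h : ((∏ p ∈ n.primeFactors, p : ℕ) : ℝ) ≤ n := Nat.cast_le.mpr this
      rwa [Nat.cast_prod] at h
  have hpp : 0 < ∏ p ∈ n.primeFactors, ((p : ℝ) - 1) := by
    refine Finset.prod_pos fun p hp => ?_
    have h2 : (2 : ℝ) ≤ p := by exact_mod_cast (Nat.prime_of_mem_primeFactors hp).two_le
    linarith
  refine le_of_mul_le_mul_right ?_ hpp
  rw [← h1']
  calc _ ≤ (n.totient : ℝ) * ((2 ^ P * (n : ℝ) ^ ε) * ∏ p ∈ n.primeFactors, ((p : ℝ) - 1)) :=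
        mul_le_mul_of_nonneg_left hprod (by positivity)
    _ = _ := by ring

lemma card_div_le (n : ℕ) : (n.divisors.card : ℝ) ≤ 2 * Real.sqrt n := by
  have h : n.divisors ⊆ (Finset.Icc 1 n.sqrt) ∪ (Finset.Icc 1 n.sqrt).image (fun d => n / d) := by
    intro d hd
    have hdn := Nat.dvd_of_mem_divisors hd
    have hn : n ≠ 0 := (Nat.mem_divisors.mp hd).2
    have hd0 : 0 < d := Nat.pos_of_mem_divisors hd
    simp only [Finset.mem_union, Finset.mem_Icc, Finset.mem_image]
    by_cases h : d ≤ n.sqrt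
    · left; exact ⟨hd0, h⟩
    · right
      refine ⟨n / d, ⟨Nat.div_pos (Nat.le_of_dvd (by omega) hdn) hd0, ?_⟩, Nat.div_div_self hdn hn⟩
      by_contra h'
      push Not at h h'
      have h1 : (n.sqrt + 1) * (n.sqrt + 1) ≤ d * (n / d) := Nat.mul_le_mul h h'
      rw [Nat.mul_div_cancel' hdn] at h1
      have := Nat.lt_succ_sqrt n
      simp only [Nat.succ_eq_add_one] at this
      omega
  have h2 : n.divisors.card ≤ n.sqrt + n.sqrt := by
    refine (Finset.card_le_card h).trans ((Finset.card_union_le _ _).trans ?_)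
    refine add_le_add (by simp) (Finset.card_image_le.trans (by simp))
  have h3 : ((n.sqrt : ℕ) : ℝ) ≤ Real.sqrt n := Real.nat_sqrt_le_real_sqrt
  have h4 : (n.divisors.card : ℝ) ≤ n.sqrt + n.sqrt := by exact_mod_cast h2
  linarith

lemma count_moebius (q N : ℕ) (hq : q ≠ 0) :
    ((((Finset.Ioc 0 N).filter (fun a => q.Coprime a)).card : ℕ) : ℤ)
      = ∑ d ∈ q.divisors, ArithmeticFunction.moebius d * ((N / d : ℕ) : ℤ) := by
  have h1 : ∀ a ∈ Finset.Ioc 0 N, (if q.Coprime a then (1 : ℤ) else 0)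
      = ∑ d ∈ q.divisors, if d ∣ a then ArithmeticFunction.moebius d else 0 := by
    intro a ha
    rw [← Finset.sum_filter]
    have : q.divisors.filter (fun d => d ∣ a) = (q.gcd a).divisors := by
      ext d
      simp only [Finset.mem_filter, Nat.mem_divisors, Nat.dvd_gcd_iff]
      have : q.gcd a ≠ 0 := by
        intro h; exact hq (Nat.gcd_eq_zero_iff.mp h).1
      tauto
    rw [this, ← ArithmeticFunction.coe_mul_zeta_apply, ArithmeticFunction.moebius_mul_coe_zeta,
      ArithmeticFunction.one_apply]
  rw [Finset.card_filter]
  push_cast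
  rw [Finset.sum_congr rfl h1, Finset.sum_comm]
  refine Finset.sum_congr rfl fun d hd => ?_
  rw [← Finset.sum_filter, Finset.sum_const, Nat.Ioc_filter_dvd_card_eq_div]
  simp [mul_comm]

lemma tot_moebius (q : ℕ) (hq : q ≠ 0) :
    (q.totient : ℝ) / q = ∑ d ∈ q.divisors, (ArithmeticFunction.moebius d : ℝ) / d := by
  have h := count_moebius q q hq
  have h2 : ((Finset.Ioc 0 q).filter (fun a => q.Coprime a)).card = q.totient := by
    rw [← Nat.filter_coprime_Ico_eq_totient q 1]
    congr 1; ext a; simp; omega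
  rw [h2] at h
  have h3 : (q.totient : ℝ) = ∑ d ∈ q.divisors, (ArithmeticFunction.moebius d : ℝ) * ((q / d : ℕ) : ℝ) := by
    have := congrArg (fun k : ℤ => (k : ℝ)) h
    simpa only [Int.cast_sum, Int.cast_mul, Int.cast_natCast] using this
  have hq' : (q : ℝ) ≠ 0 := by exact_mod_cast hq
  rw [h3, Finset.sum_div]
  refine Finset.sum_congr rfl fun d hd => ?_
  have hd' := Nat.dvd_of_mem_divisors hd
  have hd0 : (d : ℝ) ≠ 0 := by exact_mod_cast (Nat.pos_of_mem_divisors hd).ne'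
  rw [Nat.cast_div hd' hd0]
  field_simp

lemma count_approx (q N : ℕ) (hq : q ≠ 0) :
    |(((Finset.Ioc 0 N).filter (fun a => q.Coprime a)).card : ℝ) - N * ((q.totient : ℝ) / q)|
      ≤ q.divisors.card := by
  have h : (((Finset.Ioc 0 N).filter (fun a => q.Coprime a)).card : ℝ)
      = ∑ d ∈ q.divisors, (ArithmeticFunction.moebius d : ℝ) * ((N / d : ℕ) : ℝ) := by
    have := congrArg (fun k : ℤ => (k : ℝ)) (count_moebius q N hq)
    simpa only [Int.cast_sum, Int.cast_mul, Int.cast_natCast] using this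
  rw [h, tot_moebius q hq, Finset.mul_sum, ← Finset.sum_sub_distrib]
  refine (Finset.abs_sum_le_sum_abs _ _).trans ?_
  rw [Finset.card_eq_sum_ones]
  push_cast
  refine Finset.sum_le_sum fun d hd => ?_
  have hd0 : (0 : ℝ) < d := by exact_mod_cast (Nat.pos_of_mem_divisors hd)
  have e : (ArithmeticFunction.moebius d : ℝ) * ((N / d : ℕ) : ℝ) - N * ((ArithmeticFunction.moebius d : ℝ) / d)
    = (ArithmeticFunction.moebius d : ℝ) * (((N / d : ℕ) : ℝ) - (N : ℝ) / d) := by ring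
  rw [e, abs_mul]
  have h1 : |(ArithmeticFunction.moebius d : ℝ)| ≤ 1 := by
    exact_mod_cast ArithmeticFunction.abs_moebius_le_one
  have h2 : |((N / d : ℕ) : ℝ) - (N : ℝ) / d| ≤ 1 := by
    rw [← Nat.floor_div_eq_div (K := ℝ)]
    have a1 := Nat.floor_le (show (0 : ℝ) ≤ (N : ℝ) / d by positivity)
    have a2 := Nat.lt_floor_add_one ((N : ℝ) / d)
    rw [abs_le]; constructor <;> linarith
  exact mul_le_one₀ h1 (abs_nonneg _) h2

/-- counting function of reduced fractions -/
noncomputable def cnt (q : ℕ) (x : ℝ) : ℕ := ((cop q).filter (fun p : ℕ => (p : ℝ) / q ≤ x)).card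

lemma cnt_eq (q : ℕ) (hq : 2 ≤ q) (x : ℝ) (h0 : 0 ≤ x) (h1 : x ≤ 1) :
    cnt q x = ((Finset.Ioc 0 ⌊x * q⌋₊).filter (fun a => q.Coprime a)).card := by
  have hq0 : (0 : ℝ) < q := by positivity
  unfold cnt cop
  congr 1
  ext p
  simp only [Finset.mem_filter, Finset.mem_range, Finset.mem_Ioc]
  rw [div_le_iff₀ hq0, ← Nat.le_floor_iff (by positivity)]
  have hfl : ⌊x * q⌋₊ ≤ q := by
    apply Nat.floor_le_of_le; nlinarith
  constructor
  · rintro ⟨⟨a, b⟩, c⟩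
    refine ⟨⟨?_, c⟩, b⟩
    rcases Nat.eq_zero_or_pos p with h | h
    · subst h; simp at b; omega
    · exact h
  · rintro ⟨⟨a, b⟩, c⟩
    refine ⟨⟨?_, c⟩, b⟩
    rcases lt_or_eq_of_le (b.trans hfl) with h | h
    · exact h
    · subst h; simp at c; omega

lemma cnt_approx (q : ℕ) (hq : 2 ≤ q) (x : ℝ) (h0 : 0 ≤ x) (h1 : x ≤ 1) :
    |(cnt q x : ℝ) - x * q.totient| ≤ q.divisors.card + 1 := by
  have hq0 : (0 : ℝ) < q := by positivity
  rw [cnt_eq q hq x h0 h1]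
  have h := count_approx q ⌊x * q⌋₊ (by omega)
  have a1 := Nat.floor_le (show (0 : ℝ) ≤ x * q by positivity)
  have a2 := Nat.lt_floor_add_one (x * q)
  have ht : (q.totient : ℝ) / q ≤ 1 := by
    rw [div_le_one hq0]; exact_mod_cast Nat.totient_le q
  have ht0 : 0 ≤ (q.totient : ℝ) / q := by positivity
  have e : x * q.totient = (x * q) * ((q.totient : ℝ) / q) := by field_simp
  rw [e]
  rw [abs_le] at h ⊢
  constructor <;> nlinarith

lemma cnt_upper (q : ℕ) (hq : 2 ≤ q) (x : ℝ) (h0 : 0 ≤ x) :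
    (cnt q x : ℝ) ≤ x * q.totient + (q.divisors.card + 1) := by
  rcases le_total x 1 with h | h
  · have := (abs_le.mp (cnt_approx q hq x h0 h)).2; linarith
  · have : (cnt q x : ℝ) ≤ q.totient := by
      rw [← card_cop]; exact_mod_cast Finset.card_filter_le _ _
    have : (0 : ℝ) ≤ q.totient := by positivity
    nlinarith

lemma cnt_lower (q : ℕ) (hq : 2 ≤ q) (x : ℝ) (h1 : x ≤ 1) :
    x * q.totient - (q.divisors.card + 1) ≤ (cnt q x : ℝ) := by
  rcases le_total 0 x with h | h
  · have := (abs_le.mp (cnt_approx q hq x h h1)).1; linarith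
  · have : (0 : ℝ) ≤ q.totient := by positivity
    have : (0 : ℝ) ≤ cnt q x := by positivity
    have : (0 : ℝ) ≤ q.divisors.card := by positivity
    nlinarith

lemma near_count (q : ℕ) (hq : 2 ≤ q) (x r : ℝ) (hx0 : 0 ≤ x) (hx1 : x ≤ 1) (hr : 0 ≤ r) :
    (((cop q).filter (fun p : ℕ => |x - (p : ℝ) / q| ≤ r)).card : ℝ)
      ≤ 2 * r * q.totient + 3 * (q.divisors.card + 1) := by
  have hq0 : (0 : ℝ) < q := by positivity
  have h1 := cnt_upper q hq (x + r) (by linarith)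
  have h2 := cnt_lower q hq (x - r - 1 / q) (by have : 0 ≤ 1 / (q:ℝ) := by positivity
                                                linarith)
  have hsub : (cop q).filter (fun p : ℕ => |x - (p : ℝ) / q| ≤ r) ⊆
      (cop q).filter (fun p : ℕ => (p : ℝ) / q ≤ x + r) \
        (cop q).filter (fun p : ℕ => (p : ℝ) / q ≤ x - r - 1 / q) := by
    intro p hp
    simp only [Finset.mem_filter, Finset.mem_sdiff] at hp ⊢
    obtain ⟨hp, h⟩ := hp
    rw [abs_le] at h
    refine ⟨⟨hp, by linarith⟩, fun h' => ?_⟩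
    have : 0 < 1 / (q:ℝ) := by positivity
    linarith [h'.2]
  have hcard := Finset.card_le_card hsub
  have hs2 : (cop q).filter (fun p : ℕ => (p : ℝ) / q ≤ x - r - 1 / q) ⊆
     (cop q).filter (fun p : ℕ => (p : ℝ) / q ≤ x + r) := by
    intro p hp
    simp only [Finset.mem_filter] at hp ⊢
    have : 0 < 1 / (q:ℝ) := by positivity
    exact ⟨hp.1, by linarith [hp.2]⟩
  rw [Finset.card_sdiff_of_subset hs2] at hcard
  have hle := Finset.card_le_card hs2
  have hcard' : (((cop q).filter (fun p : ℕ => |x - (p : ℝ) / q| ≤ r)).card : ℝ)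
     ≤ (cnt q (x + r) : ℝ) - cnt q (x - r - 1 / q) := by
    have : ((cop q).filter (fun p : ℕ => |x - (p : ℝ) / q| ≤ r)).card + cnt q (x - r - 1 / q) ≤ cnt q (x + r) := by
      unfold cnt; omega
    have : (((cop q).filter (fun p : ℕ => |x - (p : ℝ) / q| ≤ r)).card : ℝ) + cnt q (x - r - 1 / q) ≤ cnt q (x + r) := by
      exact_mod_cast this
    linarith
  have ht : 1 / (q:ℝ) * q.totient ≤ 1 := by
    rw [one_div, inv_mul_le_iff₀ hq0, mul_one]; exact_mod_cast Nat.totient_le q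
  have : (0 : ℝ) ≤ q.divisors.card := by positivity
  nlinarith


/-- pairs of distinct reduced fractions at distance at most `r` -/
noncomputable def prs (q q' : ℕ) (r : ℝ) : Finset (ℕ × ℕ) :=
  ((cop q) ×ˢ (cop q')).filter
    (fun z => (z.1 : ℝ) / q ≠ (z.2 : ℝ) / q' ∧ |(z.1 : ℝ) / q - (z.2 : ℝ) / q'| ≤ r)

lemma prs_card_symm (q q' : ℕ) (r : ℝ) : (prs q q' r).card ≤ (prs q' q r).card := by
  refine Finset.card_le_card_of_injOn Prod.swap ?_ (Prod.swap_injective.injOn)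
  intro z hz
  simp only [prs, Finset.coe_filter, Finset.mem_product, Set.mem_ofPred_eq, Prod.fst_swap,
    Prod.snd_swap] at hz ⊢
  refine ⟨⟨hz.1.2, hz.1.1⟩, hz.2.1.symm, ?_⟩
  rw [abs_sub_comm]; exact hz.2.2

lemma prs_le_trivial (q q' : ℕ) (hq : 2 ≤ q) (hq' : 2 ≤ q') (r : ℝ) (hr : 0 ≤ r) :
    ((prs q q' r).card : ℝ) ≤ 2 * r * q * q' := by
  have hq0 : (0 : ℝ) < q := by positivity
  have hq0' : (0 : ℝ) < q' := by positivity
  obtain ⟨g, a, b, hg, hab, hqa, hqb⟩ : ∃ g a b : ℕ, 0 < g ∧ a.Coprime b ∧ q = a * g ∧ q' = b * g := by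
    refine ⟨q.gcd q', q / q.gcd q', q' / q.gcd q', Nat.gcd_pos_of_pos_left _ (by omega),
      Nat.coprime_div_gcd_div_gcd (Nat.gcd_pos_of_pos_left _ (by omega)), ?_, ?_⟩
    · exact (Nat.div_mul_cancel (Nat.gcd_dvd_left _ _)).symm
    · exact (Nat.div_mul_cancel (Nat.gcd_dvd_right _ _)).symm
  have ha : 0 < a := by rcases Nat.eq_zero_or_pos a with h | h; (subst h; simp at hqa; omega); exact h
  have hb : 0 < b := by rcases Nat.eq_zero_or_pos b with h | h; (subst h; simp at hqb; omega); exact h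
  have hgR : (0 : ℝ) < g := by exact_mod_cast hg
  have haR : (0 : ℝ) < a := by exact_mod_cast ha
  have hbR : (0 : ℝ) < b := by exact_mod_cast hb
  set T : ℕ := ⌊r * a * b * g⌋₊ with hT
  have key : (prs q q' r).card ≤ ((((Finset.Icc (-(T : ℤ)) T).erase 0) ×ˢ Finset.range g)).card := by
    refine Finset.card_le_card_of_injOn
      (fun z => ((z.1 : ℤ) * b - (z.2 : ℤ) * a, z.1 / a)) ?_ ?_
    · rintro ⟨p, p'⟩ hz
      simp only [prs, cop, Finset.coe_filter, Finset.mem_product, Set.mem_ofPred_eq,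
        Finset.mem_filter, Finset.mem_range] at hz
      obtain ⟨⟨⟨h1, _⟩, h2, _⟩, hne, hle⟩ := hz
      have hdiff : (p : ℝ) / q - (p' : ℝ) / q' = (((p : ℤ) * b - (p' : ℤ) * a : ℤ) : ℝ) / (a * b * g) := by
        rw [hqa, hqb]; push_cast; field_simp
      simp only [Finset.coe_product, Set.mem_prod, Finset.coe_erase, Set.mem_sdiff, Finset.mem_coe,
        Finset.mem_Icc, Set.mem_singleton_iff, Finset.mem_range]
      refine ⟨⟨?_, ?_⟩, ?_⟩
      · rw [← abs_le]
        rw [hdiff, abs_div, abs_of_pos (show (0:ℝ) < a * b * g by positivity), div_le_iff₀ (by positivity)] at hle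
        have : (((|(p : ℤ) * b - (p' : ℤ) * a|).toNat : ℕ) : ℝ) ≤ r * a * b * g := by
          have e : (((|(p : ℤ) * b - (p' : ℤ) * a|).toNat : ℕ) : ℝ) = |(((p : ℤ) * b - (p' : ℤ) * a : ℤ) : ℝ)| := by
            rw [← Int.cast_abs, ← Int.cast_natCast, Int.toNat_of_nonneg (abs_nonneg _)]
          rw [e]; nlinarith
        have h3 := Nat.le_floor this
        omega
      · intro h0
        apply hne
        rw [h0] at hdiff
        simp at hdiff
        linarith
      · rw [Nat.div_lt_iff_lt_mul ha]; rw [hqa] at h1; linarith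
    · rintro ⟨p, p'⟩ hz ⟨t, t'⟩ hw h
      simp only [Prod.mk.injEq] at h
      obtain ⟨h1, h2⟩ := h
      have hmod : (a : ℤ) ∣ (p : ℤ) - t := by
        have : (a : ℤ) ∣ ((p : ℤ) - t) * b := ⟨(p' : ℤ) - t', by linarith⟩
        exact IsCoprime.dvd_of_dvd_mul_right (Nat.isCoprime_iff_coprime.mpr hab) this
      have hm : p % a = t % a := by
        have h5 : (p : ℤ) % a = (t : ℤ) % a :=
          Int.emod_eq_emod_iff_emod_sub_eq_zero.mpr (Int.emod_eq_zero_of_dvd hmod)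
        exact_mod_cast h5
      have hpt : p = t := by
        rw [← Nat.div_add_mod p a, ← Nat.div_add_mod t a, h2, hm]
      subst hpt
      have : (p' : ℤ) * a = t' * a := by linarith
      have ha' : (a : ℤ) ≠ 0 := by omega
      have := mul_right_cancel₀ ha' this
      simp; exact_mod_cast this
  have hcard : ((((Finset.Icc (-(T : ℤ)) T).erase 0) ×ˢ Finset.range g)).card = 2 * T * g := by
    rw [Finset.card_product, Finset.card_erase_of_mem (by simp), Int.card_Icc, Finset.card_range]
    congr 1; omega
  rw [hcard] at key
  have hTle : (T : ℝ) ≤ r * a * b * g := Nat.floor_le (by positivity)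
  calc ((prs q q' r).card : ℝ) ≤ 2 * T * g := by exact_mod_cast key
    _ ≤ 2 * (r * a * b * g) * g := by gcongr
    _ = _ := by rw [hqa, hqb]; push_cast; ring

lemma prs_le_sum (q q' : ℕ) (hq : 2 ≤ q) (hq' : 2 ≤ q') (r : ℝ) (hr : 0 ≤ r) :
    ((prs q q' r).card : ℝ) ≤ q.totient * (2 * r * q'.totient + 3 * (q'.divisors.card + 1)) := by
  have hq0 : (0 : ℝ) < q := by positivity
  have h1 : (prs q q' r).card ≤ ∑ p ∈ cop q,
      ((cop q').filter (fun p' : ℕ => |(p : ℝ) / q - (p' : ℝ) / q'| ≤ r)).card := by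
    have : prs q q' r ⊆ (cop q).biUnion (fun p =>
      ((cop q').filter (fun p' : ℕ => |(p : ℝ) / q - (p' : ℝ) / q'| ≤ r)).image (fun p' => (p, p'))) := by
      rintro ⟨p, p'⟩ hz
      simp only [prs, Finset.mem_filter, Finset.mem_product] at hz
      simp only [Finset.mem_biUnion, Finset.mem_image, Finset.mem_filter]
      exact ⟨p, hz.1.1, p', ⟨hz.1.2, hz.2.2⟩, rfl⟩
    refine (Finset.card_le_card this).trans (Finset.card_biUnion_le.trans ?_)
    exact Finset.sum_le_sum fun p _ => Finset.card_image_le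
  have h2 : ((prs q q' r).card : ℝ) ≤ ∑ p ∈ cop q,
      (((cop q').filter (fun p' : ℕ => |(p : ℝ) / q - (p' : ℝ) / q'| ≤ r)).card : ℝ) := by
    exact_mod_cast h1
  refine h2.trans ?_
  rw [← card_cop q, ← nsmul_eq_mul]
  refine Finset.sum_le_card_nsmul _ _ _ fun p hp => ?_
  have hp' : p < q := Finset.mem_range.mp (Finset.mem_filter.mp hp).1
  refine near_count q' hq' _ r (by positivity) ?_ hr
  rw [div_le_one hq0]; exact_mod_cast hp'.le

lemma err_bound : ∃ C : ℝ, 0 < C ∧ ∀ q : ℕ, 2 ≤ q →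
    3 * ((q.divisors.card : ℝ) + 1) ≤ C * (q : ℝ) ^ (-(1/4) : ℝ) * q.totient := by
  obtain ⟨C, hC, h⟩ := tot_lower (1/4) (by norm_num)
  refine ⟨9 * C, by linarith, fun q hq => ?_⟩
  have hq0 : (0 : ℝ) < q := by positivity
  have hq1 : (1 : ℝ) ≤ q := by exact_mod_cast (by omega : 1 ≤ q)
  have h1 := h q (by omega)
  have h2 := card_div_le q
  have h3 : 1 ≤ Real.sqrt q := Real.one_le_sqrt.mpr hq1
  have e1 : Real.sqrt q = (q : ℝ) ^ (1/2 : ℝ) := Real.sqrt_eq_rpow _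
  have e2 : (q : ℝ) ^ (1/2 : ℝ) = q * (q : ℝ) ^ (-(1/4) : ℝ) * (q : ℝ) ^ (-(1/4) : ℝ) := by
    nth_rewrite 2 [← Real.rpow_one (q : ℝ)]
    rw [← Real.rpow_add hq0, ← Real.rpow_add hq0]; norm_num
  have e3 : (q : ℝ) ^ (1/4 : ℝ) * (q : ℝ) ^ (-(1/4) : ℝ) = 1 := by
    rw [← Real.rpow_add hq0]; norm_num
  have hp : 0 < (q : ℝ) ^ (-(1/4) : ℝ) := by positivity
  calc 3 * ((q.divisors.card : ℝ) + 1) ≤ 9 * Real.sqrt q := by linarith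
    _ = 9 * (q * (q : ℝ) ^ (-(1/4) : ℝ) * (q : ℝ) ^ (-(1/4) : ℝ)) := by rw [e1, e2]
    _ ≤ 9 * ((C * (q : ℝ) ^ (1/4 : ℝ) * q.totient) * (q : ℝ) ^ (-(1/4) : ℝ) * (q : ℝ) ^ (-(1/4) : ℝ)) := by
        gcongr
    _ = 9 * (C * q.totient * ((q : ℝ) ^ (1/4 : ℝ) * (q : ℝ) ^ (-(1/4) : ℝ)) * (q : ℝ) ^ (-(1/4) : ℝ)) := by ring
    _ = _ := by rw [e3]; ring

lemma prs_bound (ε : ℝ) (hε : 0 < ε) : ∃ C : ℝ, 0 < C ∧ ∀ q q' : ℕ, 2 ≤ q → 2 ≤ q' →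
    ∀ r : ℝ, 0 < r → r ≤ 1 →
    ((prs q q' r).card : ℝ) ≤ C * r ^ (1 - ε) * (q.totient * q'.totient) := by
  obtain ⟨C1, hC1, h1⟩ := tot_lower (ε / 8) (by linarith)
  obtain ⟨C2, hC2, h2⟩ := err_bound
  refine ⟨2 * C1 ^ 2 + (2 + C2), by positivity, ?_⟩
  have main : ∀ q q' : ℕ, 2 ≤ q → 2 ≤ q' → q ≤ q' → ∀ r : ℝ, 0 < r → r ≤ 1 →
    ((prs q q' r).card : ℝ) ≤ (2 * C1 ^ 2 + (2 + C2)) * r ^ (1 - ε) * (q.totient * q'.totient) := by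
    intro q q' hq hq' hqq r hr hr1
    have hq0 : (0 : ℝ) < q := by positivity
    have hq0' : (0 : ℝ) < q' := by positivity
    have hrr : r ≤ r ^ (1 - ε) := by
      nth_rewrite 1 [← Real.rpow_one r]
      exact Real.rpow_le_rpow_of_exponent_ge hr hr1 (by linarith)
    by_cases hc : (q' : ℝ) ^ (-(1/4) : ℝ) ≤ r
    · refine (prs_le_sum q q' hq hq' r hr.le).trans ?_
      have h3 := h2 q' hq'
      calc (q.totient : ℝ) * (2 * r * q'.totient + 3 * (q'.divisors.card + 1))
          ≤ q.totient * (2 * r * q'.totient + C2 * r * q'.totient) := by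
            have : C2 * (q' : ℝ) ^ (-(1/4) : ℝ) * q'.totient ≤ C2 * r * q'.totient := by gcongr
            refine mul_le_mul_of_nonneg_left ?_ (by positivity)
            linarith
        _ = (2 + C2) * r * (q.totient * q'.totient) := by ring
        _ ≤ (2 * C1 ^ 2 + (2 + C2)) * r ^ (1 - ε) * (q.totient * q'.totient) := by
            refine mul_le_mul_of_nonneg_right ?_ (by positivity)
            refine mul_le_mul ?_ hrr hr.le (by positivity)
            nlinarith [sq_nonneg C1]
    · push Not at hc
      refine (prs_le_trivial q q' hq hq' r hr.le).trans ?_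
      have a1 := h1 q (by omega)
      have a2 := h1 q' (by omega)
      have a3 : (q : ℝ) ^ (ε / 8) ≤ (q' : ℝ) ^ (ε / 8) :=
        Real.rpow_le_rpow hq0.le (by exact_mod_cast hqq) (by linarith)
      have a4 : (q' : ℝ) ^ (ε / 8) * (q' : ℝ) ^ (ε / 8) ≤ r ^ (-ε) := by
        rw [← Real.rpow_add hq0']
        calc (q' : ℝ) ^ (ε / 8 + ε / 8) = ((q' : ℝ) ^ (-(1/4) : ℝ)) ^ (-ε) := by
              rw [← Real.rpow_mul hq0'.le]; congr 1; ring
          _ ≤ r ^ (-ε) := Real.rpow_le_rpow_of_nonpos hr hc.le (by linarith)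
      have a5 : r * r ^ (-ε) = r ^ (1 - ε) := by
        nth_rewrite 1 [← Real.rpow_one r]
        rw [← Real.rpow_add hr]; ring_nf
      calc 2 * r * q * q' ≤ 2 * r * (C1 * (q' : ℝ) ^ (ε / 8) * q.totient) * (C1 * (q' : ℝ) ^ (ε / 8) * q'.totient) := by
            gcongr
            refine a1.trans ?_
            gcongr
        _ = 2 * C1 ^ 2 * (r * ((q' : ℝ) ^ (ε / 8) * (q' : ℝ) ^ (ε / 8))) * (q.totient * q'.totient) := by ring
        _ ≤ 2 * C1 ^ 2 * (r * r ^ (-ε)) * (q.totient * q'.totient) := by gcongr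
        _ = 2 * C1 ^ 2 * r ^ (1 - ε) * (q.totient * q'.totient) := by rw [a5]
        _ ≤ _ := by
          gcongr
          linarith
  intro q q' hq hq' r hr hr1
  rcases le_total q q' with h | h
  · exact main q q' hq hq' h r hr hr1
  · have := main q' q hq' hq h r hr hr1
    have h3 : ((prs q q' r).card : ℝ) ≤ (prs q' q r).card := by exact_mod_cast prs_card_symm q q' r
    rw [mul_comm (q.totient : ℝ)]
    exact h3.trans this


lemma energy_gen {ι : Type*} (T : Finset ι) (d : ι → ℝ) (r0 A s t : ℝ) (hr0 : 0 < r0) (hA : 0 ≤ A)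
    (hs : 0 < s) (hst : s < t) (hd : ∀ i ∈ T, 0 < d i ∧ d i ≤ r0)
    (hcount : ∀ r, 0 < r → r ≤ r0 → ((T.filter (fun i => d i ≤ r)).card : ℝ) ≤ A * r ^ t) :
    ∑ i ∈ T, (d i) ^ (-s) ≤ A * (2 ^ s / (1 - (1/2 : ℝ) ^ (t - s))) * r0 ^ (t - s) := by
  have hk : ∀ i, ∃ k : ℕ, i ∈ T → (1/2 : ℝ) ^ (k + 1) < d i / r0 ∧ d i / r0 ≤ (1/2 : ℝ) ^ k := by
    intro i
    by_cases hi : i ∈ T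
    · obtain ⟨h1, h2⟩ := hd i hi
      obtain ⟨k, hk⟩ := exists_nat_pow_near_of_lt_one (show 0 < d i / r0 by positivity)
        (by rw [div_le_one hr0]; exact h2) (show (0 : ℝ) < 1/2 by norm_num) (by norm_num)
      exact ⟨k, fun _ => hk⟩
    · exact ⟨0, fun h => absurd h hi⟩
  choose k hk using hk
  set N := T.sup k + 1 with hN
  set ρ : ℕ → ℝ := fun j => (1/2 : ℝ) ^ j * r0 with hρ
  have hρpos : ∀ j, 0 < ρ j := fun j => by simp only [hρ]; positivity
  have hρle : ∀ j, ρ j ≤ r0 := fun j => by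
    simp only [hρ]
    have : (1/2 : ℝ) ^ j ≤ 1 := pow_le_one₀ (by norm_num) (by norm_num)
    nlinarith
  have hpt : ∀ i ∈ T, (d i) ^ (-s) ≤
      ∑ j ∈ Finset.range N, if d i ≤ ρ j then 2 ^ s * (ρ j) ^ (-s) else 0 := by
    intro i hi
    obtain ⟨h1, h2⟩ := hk i hi
    rw [lt_div_iff₀ hr0] at h1
    rw [div_le_iff₀ hr0] at h2
    have hmem : k i ∈ Finset.range N := by
      rw [Finset.mem_range, hN]
      exact Nat.lt_succ_of_le (Finset.le_sup hi)
    refine le_trans ?_ (Finset.single_le_sum (f := fun j => if d i ≤ ρ j then 2 ^ s * (ρ j) ^ (-s) else 0) (fun j _ => ?_) hmem)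
    · rw [if_pos h2]
      have e : (2 : ℝ) ^ s * (ρ (k i)) ^ (-s) = ((1/2 : ℝ) * ρ (k i)) ^ (-s) := by
        rw [Real.mul_rpow (by norm_num) (hρpos _).le]
        congr 1
        rw [Real.rpow_neg (by norm_num), one_div, Real.inv_rpow (by norm_num), inv_inv]
      rw [e]
      refine Real.rpow_le_rpow_of_nonpos (by have := hρpos (k i); positivity) ?_ (by linarith)
      simp only [hρ]
      rw [pow_succ] at h1
      linarith
    · have := hρpos j
      split_ifs <;> positivity
  calc ∑ i ∈ T, (d i) ^ (-s)
      ≤ ∑ i ∈ T, ∑ j ∈ Finset.range N, (if d i ≤ ρ j then 2 ^ s * (ρ j) ^ (-s) else 0) :=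
        Finset.sum_le_sum hpt
    _ = ∑ j ∈ Finset.range N, ∑ i ∈ T, (if d i ≤ ρ j then 2 ^ s * (ρ j) ^ (-s) else 0) :=
        Finset.sum_comm
    _ ≤ ∑ j ∈ Finset.range N, (A * 2 ^ s * r0 ^ (t - s)) * ((1/2 : ℝ) ^ (t - s)) ^ j := by
        refine Finset.sum_le_sum fun j _ => ?_
        rw [← Finset.sum_filter, Finset.sum_const, nsmul_eq_mul]
        have h := hcount (ρ j) (hρpos j) (hρle j)
        have hp := hρpos j
        have e : (ρ j) ^ t * (ρ j) ^ (-s) = r0 ^ (t - s) * ((1/2 : ℝ) ^ (t - s)) ^ j := by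
          rw [← Real.rpow_add hp]
          simp only [hρ]
          rw [Real.mul_rpow (by positivity) hr0.le, mul_comm, ← sub_eq_add_neg]
          congr 1
          rw [← Real.rpow_natCast, ← Real.rpow_natCast, ← Real.rpow_mul (by norm_num),
            ← Real.rpow_mul (by norm_num), mul_comm]
        calc _ ≤ (A * (ρ j) ^ t) * (2 ^ s * (ρ j) ^ (-s)) := by gcongr
          _ = (A * 2 ^ s) * ((ρ j) ^ t * (ρ j) ^ (-s)) := by ring
          _ = _ := by rw [e]; ring
    _ = (A * 2 ^ s * r0 ^ (t - s)) * ∑ j ∈ Finset.range N, ((1/2 : ℝ) ^ (t - s)) ^ j := by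
        rw [Finset.mul_sum]
    _ ≤ (A * 2 ^ s * r0 ^ (t - s)) * (1 / (1 - (1/2 : ℝ) ^ (t - s))) := by
        have hlt : (1/2 : ℝ) ^ (t - s) < 1 := Real.rpow_lt_one (by norm_num) (by norm_num) (by linarith)
        refine mul_le_mul_of_nonneg_left ?_ (by positivity)
        rw [one_div (1 - _), ← tsum_geometric_of_lt_one (by positivity) hlt]
        exact (summable_geometric_of_lt_one (by positivity) hlt).sum_le_tsum _ (fun _ _ => by positivity)
    _ = _ := by ring

lemma energy_bound (s : ℝ) (hs0 : 0 < s) (hs1 : s < 1) : ∃ C : ℝ, 0 < C ∧ ∀ q q' : ℕ, 2 ≤ q → 2 ≤ q' →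
    ∀ r : ℝ, 0 < r → r ≤ 1 →
    ∑ z ∈ prs q q' r, |(z.1 : ℝ) / q - (z.2 : ℝ) / q'| ^ (-s)
      ≤ C * r ^ ((1 - s) / 2) * (q.totient * q'.totient) := by
  obtain ⟨C, hC, h⟩ := prs_bound ((1 - s) / 2) (by linarith)
  have hlt : (1/2 : ℝ) ^ ((1 - s) / 2) < 1 := Real.rpow_lt_one (by norm_num) (by norm_num) (by linarith)
  have hlt' : 0 < 1 - (1/2 : ℝ) ^ ((1 - s) / 2) := by linarith
  refine ⟨C * (2 ^ s / (1 - (1/2 : ℝ) ^ ((1 - s) / 2))), by positivity, fun q q' hq hq' r hr hr1 => ?_⟩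
  have := energy_gen (prs q q' r) (fun z => |(z.1 : ℝ) / q - (z.2 : ℝ) / q'|) r
    (C * (q.totient * q'.totient)) s (1 - (1 - s) / 2) hr (by positivity) hs0 (by linarith)
    (fun z hz => ?_) (fun r' hr' hr'' => ?_)
  · have e : 1 - (1 - s) / 2 - s = (1 - s) / 2 := by ring
    rw [e] at this
    refine this.trans (le_of_eq ?_)
    ring
  · simp only [prs, Finset.mem_filter] at hz
    exact ⟨abs_pos.mpr (sub_ne_zero.mpr hz.2.1), hz.2.2⟩
  · have h1 := h q q' hq hq' r' hr' (hr''.trans hr1)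
    have h2 : ((prs q q' r).filter (fun z => |(z.1 : ℝ) / q - (z.2 : ℝ) / q'| ≤ r')) ⊆ prs q q' r' := by
      intro z hz
      simp only [prs, Finset.mem_filter] at hz ⊢
      exact ⟨hz.1.1, hz.1.2.1, hz.2⟩
    calc _ ≤ ((prs q q' r').card : ℝ) := by exact_mod_cast Finset.card_le_card h2
      _ ≤ _ := h1
      _ = _ := by ring


/-- normalised smooth bump at `c` with radius `ρ` -/
noncomputable def bmp (ρ c : ℝ) (x : ℝ) : ℝ :=
  if h : 0 < ρ then (⟨ρ / 2, ρ, by linarith, by linarith⟩ : ContDiffBump c).normed volume x else 0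

lemma bmp_contDiff (ρ c : ℝ) (hρ : 0 < ρ) : ContDiff ℝ 1 (bmp ρ c) := by
  have : bmp ρ c = (⟨ρ / 2, ρ, by linarith, by linarith⟩ : ContDiffBump c).normed volume := by
    ext x; simp [bmp, hρ]
  rw [this]
  exact ContDiffBump.contDiff_normed (n := 1) _

lemma bmp_nonneg (ρ c x : ℝ) : 0 ≤ bmp ρ c x := by
  unfold bmp
  split_ifs with h
  · exact ContDiffBump.nonneg_normed _ _
  · exact le_rfl

lemma bmp_le (ρ c x : ℝ) (hρ : 0 < ρ) : bmp ρ c x ≤ ρ⁻¹ := by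
  unfold bmp
  rw [dif_pos hρ]
  refine (ContDiffBump.normed_le_div_measure_closedBall_rIn _ _ _).trans ?_
  simp only [Measure.real, Real.volume_closedBall]
  rw [ENNReal.toReal_ofReal (by linarith), one_div]
  apply le_of_eq; congr 1; ring

lemma bmp_support (ρ c : ℝ) (hρ : 0 < ρ) : Function.support (bmp ρ c) = Metric.ball c ρ := by
  have : bmp ρ c = (⟨ρ / 2, ρ, by linarith, by linarith⟩ : ContDiffBump c).normed volume := by
    ext x; simp [bmp, hρ]
  rw [this, ContDiffBump.support_normed_eq]

lemma bmp_integral (ρ c : ℝ) (hρ : 0 < ρ) : ∫ x, bmp ρ c x = 1 := by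
  have : bmp ρ c = (⟨ρ / 2, ρ, by linarith, by linarith⟩ : ContDiffBump c).normed volume := by
    ext x; simp [bmp, hρ]
  rw [this, ContDiffBump.integral_normed]

lemma bmp_integrable (ρ c : ℝ) (hρ : 0 < ρ) : Integrable (bmp ρ c) := by
  have : bmp ρ c = (⟨ρ / 2, ρ, by linarith, by linarith⟩ : ContDiffBump c).normed volume := by
    ext x; simp [bmp, hρ]
  rw [this]; exact ContDiffBump.integrable_normed _

lemma bmp_int_nonneg (ρ c a b : ℝ) (hab : a ≤ b) : 0 ≤ ∫ x in a..b, bmp ρ c x :=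
  intervalIntegral.integral_nonneg hab fun x _ => bmp_nonneg _ _ _

lemma bmp_int_le_one (ρ c a b : ℝ) (hρ : 0 < ρ) (hab : a ≤ b) : ∫ x in a..b, bmp ρ c x ≤ 1 := by
  rw [← bmp_integral ρ c hρ, intervalIntegral.integral_of_le hab]
  exact setIntegral_le_integral (bmp_integrable ρ c hρ) (Eventually.of_forall fun x => bmp_nonneg _ _ _)

lemma bmp_int_eq_one (ρ c a b : ℝ) (hρ : 0 < ρ) (ha : a ≤ c - ρ) (hb : c + ρ ≤ b) :
    ∫ x in a..b, bmp ρ c x = 1 := by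
  rw [← bmp_integral ρ c hρ]
  apply intervalIntegral.integral_eq_integral_of_support_subset
  rw [bmp_support ρ c hρ, Real.ball_eq_Ioo]
  exact (Ioo_subset_Ioo ha hb).trans Ioo_subset_Ioc_self

lemma bmp_eq_zero (ρ c x : ℝ) (hρ : 0 < ρ) (h : ρ ≤ |x - c|) : bmp ρ c x = 0 := by
  have : x ∉ Function.support (bmp ρ c) := by
    rw [bmp_support ρ c hρ, Metric.mem_ball, Real.dist_eq]; linarith
  simpa using this

lemma bmp_int_eq_zero (ρ c a b : ℝ) (hρ : 0 < ρ) (hab : a ≤ b) (h : b ≤ c - ρ ∨ c + ρ ≤ a) :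
    ∫ x in a..b, bmp ρ c x = 0 := by
  apply intervalIntegral.integral_zero_ae
  refine Eventually.of_forall fun x hx => bmp_eq_zero ρ c x hρ ?_
  rw [uIoc_of_le hab] at hx
  rcases h with h | h
  · rw [abs_sub_comm]; exact le_trans (by linarith [hx.2]) (le_abs_self _)
  · exact le_trans (by linarith [hx.1]) (le_abs_self _)

lemma bmp_int_le (ρ c a b : ℝ) (hρ : 0 < ρ) (hab : a ≤ b) :
    ∫ x in a..b, bmp ρ c x ≤ (b - a) / ρ := by
  have h := intervalIntegral.integral_mono_on hab
    ((bmp_contDiff ρ c hρ).continuous.intervalIntegrable (μ := volume) a b)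
    (intervalIntegrable_const (c := ρ⁻¹)) (fun x _ => bmp_le ρ c x hρ)
  rw [intervalIntegral.integral_const, smul_eq_mul] at h
  rwa [div_eq_mul_inv]

/-- sum of bumps around the reduced fractions with denominator `q` -/
noncomputable def Hq (ρ : ℝ) (q : ℕ) (x : ℝ) : ℝ := ∑ p ∈ cop q, bmp ρ ((p : ℝ) / q) x

lemma Hq_contDiff (ρ : ℝ) (q : ℕ) (hρ : 0 < ρ) : ContDiff ℝ 1 (Hq ρ q) := by
  unfold Hq
  exact ContDiff.sum fun p _ => bmp_contDiff _ _ hρ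

lemma cop_pos (q p : ℕ) (hq : 2 ≤ q) (hp : p ∈ cop q) : 1 ≤ p ∧ p < q := by
  simp only [cop, Finset.mem_filter, Finset.mem_range] at hp
  refine ⟨?_, hp.1⟩
  rcases Nat.eq_zero_or_pos p with h | h
  · subst h; simp at hp; omega
  · exact h

lemma Hq_int (ρ : ℝ) (q : ℕ) (hρ : 0 < ρ) (hq : 2 ≤ q) (hρq : ρ ≤ 1 / (2 * q)) (x : ℝ)
    (hx0 : 0 ≤ x) (hx1 : x ≤ 1) :
    |(∫ t in (0:ℝ)..x, Hq ρ q t) - x * q.totient| ≤ ρ * q.totient + (q.divisors.card + 1) := by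
  have hq0 : (0 : ℝ) < q := by positivity
  have e : (∫ t in (0:ℝ)..x, Hq ρ q t) = ∑ p ∈ cop q, ∫ t in (0:ℝ)..x, bmp ρ ((p : ℝ) / q) t := by
    unfold Hq
    exact intervalIntegral.integral_finsetSum fun p _ =>
      ((bmp_contDiff ρ _ hρ).continuous.intervalIntegrable _ _)
  have h1 : (∫ t in (0:ℝ)..x, Hq ρ q t) ≤ cnt q (x + ρ) := by
    rw [e, cnt, Finset.card_filter]
    push_cast
    refine Finset.sum_le_sum fun p hp => ?_
    split_ifs with h
    · exact bmp_int_le_one _ _ _ _ hρ hx0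
    · push Not at h
      rw [bmp_int_eq_zero _ _ _ _ hρ hx0 (Or.inl (by linarith))]
  have h2 : (cnt q (x - ρ) : ℝ) ≤ (∫ t in (0:ℝ)..x, Hq ρ q t) := by
    rw [e, cnt, Finset.card_filter]
    push_cast
    refine Finset.sum_le_sum fun p hp => ?_
    split_ifs with h
    · have hp1 : (1 : ℝ) ≤ p := by exact_mod_cast (cop_pos q p hq hp).1
      rw [bmp_int_eq_one _ _ _ _ hρ ?_ (by linarith)]
      have : 1 / (2 * (q : ℝ)) ≤ p / q := by
        rw [div_le_div_iff₀ (by positivity) hq0]; nlinarith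
      linarith
    · exact bmp_int_nonneg _ _ _ _ hx0
  have h3 := cnt_upper q hq (x + ρ) (by linarith)
  have h4 := cnt_lower q hq (x - ρ) (by linarith)
  rw [abs_le]; constructor <;> linarith

lemma Hq_parts (ρ : ℝ) (q : ℕ) (hρ : 0 < ρ) (hq : 2 ≤ q) (hρq : ρ ≤ 1 / (2 * q))
    (f : ℝ → ℝ) (hf : ContDiff ℝ 1 f) (F F' : ℝ) (hF : ∀ x ∈ Icc (0:ℝ) 1, |f x| ≤ F)
    (hF' : ∀ x ∈ Icc (0:ℝ) 1, |deriv f x| ≤ F') (a b : ℝ) (ha : 0 ≤ a) (hab : a ≤ b) (hb : b ≤ 1) :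
    |(∫ x in a..b, f x * Hq ρ q x) - (∫ x in a..b, f x) * q.totient|
      ≤ (2 * F + F') * (ρ * q.totient + (q.divisors.card + 1)) := by
  set δ := ρ * q.totient + (q.divisors.card + 1) with hδ
  have hδ0 : 0 ≤ δ := by positivity
  set E : ℝ → ℝ := fun x => (∫ t in (0:ℝ)..x, Hq ρ q t) - x * q.totient with hE
  have hEb : ∀ x ∈ Icc (0:ℝ) 1, |E x| ≤ δ := fun x hx => Hq_int ρ q hρ hq hρq x hx.1 hx.2
  have hcont := (Hq_contDiff ρ q hρ).continuous
  have hEd : ∀ x, HasDerivAt E (Hq ρ q x - q.totient) x := by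
    intro x
    have h1 := (hcont.integral_hasStrictDerivAt 0 x).hasDerivAt
    have h2 : HasDerivAt (fun x : ℝ => x * (q.totient : ℝ)) (1 * q.totient) x :=
      (hasDerivAt_id x).mul_const _
    rw [one_mul] at h2
    exact h1.sub h2
  have hfd : ∀ x, HasDerivAt f (deriv f x) x := fun x =>
    (hf.differentiable (by norm_num) x).hasDerivAt
  have hf'c : Continuous (deriv f) := hf.continuous_deriv le_rfl
  have hEc : Continuous E := continuous_iff_continuousAt.mpr fun x => (hEd x).continuousAt
  have hparts := intervalIntegral.integral_deriv_mul_eq_sub (a := a) (b := b)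
    (fun x _ => hfd x) (fun x _ => hEd x) (hf'c.intervalIntegrable _ _)
    ((hcont.sub continuous_const).intervalIntegrable _ _)
  have e1 : (∫ x in a..b, deriv f x * E x + f x * (Hq ρ q x - q.totient))
     = (∫ x in a..b, deriv f x * E x) + ((∫ x in a..b, f x * Hq ρ q x) - (∫ x in a..b, f x) * q.totient) := by
    rw [← intervalIntegral.integral_mul_const, ← intervalIntegral.integral_sub, ← intervalIntegral.integral_add]
    · congr 1; ext x; ring
    · exact (hf'c.mul hEc).intervalIntegrable _ _
    · exact ((hf.continuous.mul hcont).sub (hf.continuous.mul continuous_const)).intervalIntegrable _ _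
    · exact (hf.continuous.mul hcont).intervalIntegrable _ _
    · exact (hf.continuous.mul continuous_const).intervalIntegrable _ _
  have hF0 : 0 ≤ F := (abs_nonneg _).trans (hF 0 (by simp))
  have hF0' : 0 ≤ F' := (abs_nonneg _).trans (hF' 0 (by simp))
  have e2 : |∫ x in a..b, deriv f x * E x| ≤ F' * δ := by
    have := intervalIntegral.norm_integral_le_of_norm_le_const (a := a) (b := b) (C := F' * δ)
      (f := fun x => deriv f x * E x) (fun x hx => by
        rw [uIoc_of_le hab] at hx
        have hx' : x ∈ Icc (0:ℝ) 1 := ⟨by linarith [hx.1], by linarith [hx.2]⟩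
        rw [Real.norm_eq_abs, abs_mul]
        exact mul_le_mul (hF' x hx') (hEb x hx') (abs_nonneg _) hF0')
    rw [Real.norm_eq_abs] at this
    refine this.trans ?_
    have : |b - a| ≤ 1 := by rw [abs_of_nonneg (by linarith)]; linarith
    exact mul_le_of_le_one_right (by positivity) this
  have e3 : |f b * E b| ≤ F * δ := by
    rw [abs_mul]
    exact mul_le_mul (hF b ⟨by linarith, hb⟩) (hEb b ⟨by linarith, hb⟩) (abs_nonneg _) hF0
  have e4 : |f a * E a| ≤ F * δ := by
    rw [abs_mul]
    exact mul_le_mul (hF a ⟨by linarith, by linarith⟩) (hEb a ⟨by linarith, by linarith⟩) (abs_nonneg _) hF0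
  rw [e1] at hparts
  rw [abs_le] at e2 e3 e4 ⊢
  constructor <;> linarith [e2.1, e2.2, e3.1, e3.2, e4.1, e4.2]

lemma equi (f : ℝ → ℝ) (hf : ContDiff ℝ 1 f) (δ : ℝ) (hδ : 0 < δ) :
    ∃ Q : ℕ, ∀ q : ℕ, Q ≤ q → 2 ≤ q → ∀ ρ : ℝ, 0 < ρ → ρ ≤ 1 / (2 * q) →
      ∀ a b : ℝ, 0 ≤ a → a ≤ b → b ≤ 1 →
      |(∫ x in a..b, f x * Hq ρ q x) - (∫ x in a..b, f x) * q.totient| ≤ δ * q.totient := by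
  obtain ⟨F, hF⟩ := isCompact_Icc.exists_bound_of_continuousOn (s := Icc (0:ℝ) 1) hf.continuous.continuousOn
  obtain ⟨F', hF'⟩ := isCompact_Icc.exists_bound_of_continuousOn (s := Icc (0:ℝ) 1)
    (hf.continuous_deriv le_rfl).continuousOn
  obtain ⟨C, hC, hCb⟩ := err_bound
  have hF0 : 0 ≤ F := (norm_nonneg _).trans (hF 0 (by simp))
  have hF0' : 0 ≤ F' := (norm_nonneg _).trans (hF' 0 (by simp))
  have hlim : Tendsto (fun q : ℕ => (2 * F + F') * (1 / (q : ℝ) + C * (q : ℝ) ^ (-(1/4) : ℝ))) atTop (nhds 0) := by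
    have h1 : Tendsto (fun q : ℕ => 1 / (q : ℝ)) atTop (nhds 0) := tendsto_one_div_atTop_nhds_zero_nat
    have h2 : Tendsto (fun q : ℕ => (q : ℝ) ^ (-(1/4) : ℝ)) atTop (nhds 0) :=
      (tendsto_rpow_neg_atTop (by norm_num : (0:ℝ) < 1/4)).comp tendsto_natCast_atTop_atTop
    simpa using (h1.add (h2.const_mul C)).const_mul (2 * F + F')
  obtain ⟨Q, hQ⟩ := eventually_atTop.mp (hlim.eventually (ge_mem_nhds hδ))
  refine ⟨Q, fun q hqQ hq ρ hρ hρq a b ha hab hb => ?_⟩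
  refine (Hq_parts ρ q hρ hq hρq f hf F F' hF hF' a b ha hab hb).trans ?_
  have h1 := hQ q hqQ
  have h2 := hCb q hq
  have hq0 : (0 : ℝ) < q := by positivity
  have h3 : ρ ≤ 1 / q := hρq.trans (by
    rw [div_le_div_iff₀ (by positivity) hq0]; nlinarith)
  have h4 : (0:ℝ) ≤ q.divisors.card := by positivity
  calc (2 * F + F') * (ρ * q.totient + (q.divisors.card + 1))
      ≤ (2 * F + F') * (1 / q * q.totient + C * (q : ℝ) ^ (-(1/4) : ℝ) * q.totient) := by
        gcongr
        linarith
    _ = ((2 * F + F') * (1 / q + C * (q : ℝ) ^ (-(1/4) : ℝ))) * q.totient := by ring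
    _ ≤ _ := by gcongr


lemma small_claim {ι : Type*} [DecidableEq ι] (G : Finset ι) (x ρ : ι → ℝ) (s r0 : ℝ) (hs0 : 0 < s) (hs1 : s < 1)
    (hρ : ∀ i ∈ G, 0 < ρ i) (hρ8 : ∀ i ∈ G, 8 * ρ i ≤ r0)
    (hinj : ∀ i ∈ G, ∀ j ∈ G, x i = x j → i = j)
    (hV : ∀ i ∈ G, ∑ j ∈ G.filter (fun j => x i ≠ x j ∧ |x i - x j| ≤ r0),
      ρ j ^ s * |x i - x j| ^ (-s) ≤ 1 / 8)
    (a b : ℝ) (hab : a ≤ b) (hr : b - a ≤ r0 / 4) :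
    ∑ i ∈ G, ρ i ^ s * ∫ t in a..b, bmp (ρ i) (x i) t ≤ 2 * (b - a) ^ s := by
  have hr0 : 0 ≤ b - a := by linarith
  have single : ∀ i ∈ G, ρ i ^ s * (∫ t in a..b, bmp (ρ i) (x i) t) ≤ (b - a) ^ s := by
    intro i hi
    have hp := hρ i hi
    set v := ∫ t in a..b, bmp (ρ i) (x i) t with hv
    have v0 : 0 ≤ v := bmp_int_nonneg _ _ _ _ hab
    have v1 : v ≤ 1 := bmp_int_le_one _ _ _ _ hp hab
    have v2 : v ≤ (b - a) / ρ i := bmp_int_le _ _ _ _ hp hab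
    have v3 : v ≤ v ^ s := by
      rcases eq_or_lt_of_le v0 with h | h
      · rw [← h, Real.zero_rpow hs0.ne']
      · nth_rewrite 1 [← Real.rpow_one v]
        exact Real.rpow_le_rpow_of_exponent_ge h v1 hs1.le
    calc ρ i ^ s * v ≤ ρ i ^ s * ((b - a) / ρ i) ^ s := by
          gcongr
          exact v3.trans (Real.rpow_le_rpow v0 v2 hs0.le)
      _ = (b - a) ^ s := by
          rw [← Real.mul_rpow hp.le (by positivity)]
          congr 1; field_simp
  set T := G.filter (fun i => x i - ρ i < b ∧ a < x i + ρ i) with hT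
  have hTsum : ∑ i ∈ G, ρ i ^ s * (∫ t in a..b, bmp (ρ i) (x i) t)
      = ∑ i ∈ T, ρ i ^ s * (∫ t in a..b, bmp (ρ i) (x i) t) := by
    symm
    apply Finset.sum_subset (Finset.filter_subset _ _)
    intro i hi hiT
    rw [bmp_int_eq_zero _ _ _ _ (hρ i hi) hab, mul_zero]
    by_contra h
    push Not at h
    exact hiT (Finset.mem_filter.mpr ⟨hi, by linarith, by linarith⟩)
  rw [hTsum]
  rcases T.eq_empty_or_nonempty with h | ⟨i, hi⟩
  · rw [h, Finset.sum_empty]; positivity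
  have hiG : i ∈ G := (Finset.mem_filter.mp hi).1
  rw [← Finset.add_sum_erase T _ hi]
  have key : ∀ i ∈ G, ∀ j ∈ G, x i ≠ x j → |x i - x j| ≤ r0 → ρ j ≤ |x i - x j| / 8 := by
    intro i hi j hj hne hle
    have hd : 0 < |x i - x j| := abs_pos.mpr (sub_ne_zero.mpr hne)
    have h1 : ρ j ^ s * |x i - x j| ^ (-s) ≤ 1 / 8 := by
      refine le_trans ?_ (hV i hi)
      exact Finset.single_le_sum (f := fun j => ρ j ^ s * |x i - x j| ^ (-s))
        (fun k hk => by
          have := hρ k (Finset.mem_filter.mp hk).1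
          positivity) (Finset.mem_filter.mpr ⟨hj, hne, hle⟩)
    have h2 : (8 : ℝ) ^ s ≤ 8 := by
      nth_rewrite 2 [← Real.rpow_one 8]
      exact Real.rpow_le_rpow_of_exponent_le (by norm_num) hs1.le
    rw [Real.rpow_neg hd.le, ← div_eq_mul_inv, div_le_iff₀ (by positivity)] at h1
    have h3 : ρ j ^ s ≤ (|x i - x j| / 8) ^ s := by
      rw [Real.div_rpow hd.le (by norm_num)]
      refine h1.trans ?_
      rw [one_div, inv_mul_eq_div]
      gcongr
    exact (Real.rpow_le_rpow_iff (hρ j hj).le (by positivity) hs0).mp h3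
  have others : ∀ j ∈ T.erase i, j ∈ G.filter (fun j => x i ≠ x j ∧ |x i - x j| ≤ r0) ∧
      |x i - x j| ≤ 2 * (b - a) := by
    intro j hj
    obtain ⟨hji, hjT⟩ := Finset.mem_erase.mp hj
    obtain ⟨hjG, hj1, hj2⟩ := Finset.mem_filter.mp hjT
    obtain ⟨_, hi1, hi2⟩ := Finset.mem_filter.mp hi
    have hne : x i ≠ x j := fun h => hji (hinj i hiG j hjG h).symm
    have hlt : |x i - x j| ≤ (b - a) + ρ i + ρ j := by
      rw [abs_le]; constructor <;> linarith
    have hle : |x i - x j| ≤ r0 := by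
      have h1 := hρ8 i hiG
      have h2 := hρ8 j hjG
      linarith [hρ i hiG]
    have k1 := key i hiG j hjG hne hle
    have k2 := key j hjG i hiG hne.symm (by rw [abs_sub_comm]; exact hle)
    rw [abs_sub_comm] at k2
    exact ⟨Finset.mem_filter.mpr ⟨hjG, hne, hle⟩, by linarith⟩
  have hrest : ∑ j ∈ T.erase i, ρ j ^ s * (∫ t in a..b, bmp (ρ j) (x j) t) ≤ (b - a) ^ s := by
    calc ∑ j ∈ T.erase i, ρ j ^ s * (∫ t in a..b, bmp (ρ j) (x j) t)
        ≤ ∑ j ∈ T.erase i, (ρ j ^ s * |x i - x j| ^ (-s)) * (2 * (b - a)) ^ s := by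
          refine Finset.sum_le_sum fun j hj => ?_
          obtain ⟨h1, h2⟩ := others j hj
          obtain ⟨hjG, hne, _⟩ := Finset.mem_filter.mp h1
          have hd : 0 < |x i - x j| := abs_pos.mpr (sub_ne_zero.mpr hne)
          have hp := hρ j hjG
          rw [mul_assoc]
          refine mul_le_mul_of_nonneg_left ?_ (by positivity)
          refine (bmp_int_le_one _ _ _ _ hp hab).trans ?_
          have h3 : |x i - x j| ^ s ≤ (2 * (b - a)) ^ s := Real.rpow_le_rpow hd.le h2 hs0.le
          rw [Real.rpow_neg hd.le, inv_mul_eq_div, one_le_div (by positivity)]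
          exact h3
      _ = (∑ j ∈ T.erase i, (ρ j ^ s * |x i - x j| ^ (-s))) * (2 * (b - a)) ^ s := by
          rw [Finset.sum_mul]
      _ ≤ (1 / 8) * (2 * (b - a)) ^ s := by
          refine mul_le_mul_of_nonneg_right ?_ (by positivity)
          refine le_trans ?_ (hV i hiG)
          refine Finset.sum_le_sum_of_subset_of_nonneg (fun j hj => (others j hj).1) ?_
          intro j hj _
          have := hρ j (Finset.mem_filter.mp hj).1
          positivity
      _ ≤ (b - a) ^ s := by
          rw [Real.mul_rpow (by norm_num) hr0]
          have h2 : (2 : ℝ) ^ s ≤ 2 := by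
            nth_rewrite 2 [← Real.rpow_one 2]
            exact Real.rpow_le_rpow_of_exponent_le (by norm_num) hs1.le
          have : 0 ≤ (b - a) ^ s := by positivity
          nlinarith
  have := single i hiG
  linarith

lemma exists_block (a : ℕ → ℝ) (h0 : ∀ q, 0 ≤ a q) (h1 : ∀ q, a q ≤ 1) (hns : ¬ Summable a)
    (M0 : ℝ) (hM : 0 < M0) (Q : ℕ) : ∃ N, M0 ≤ ∑ q ∈ Finset.Ico Q N, a q ∧ ∑ q ∈ Finset.Ico Q N, a q ≤ M0 + 1 := by
  have ht := (not_summable_iff_tendsto_nat_atTop_of_nonneg h0).mp hns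
  have hex : ∃ N, M0 ≤ ∑ q ∈ Finset.Ico Q N, a q := by
    obtain ⟨N, hN, hQN⟩ := ((tendsto_atTop.mp ht (M0 + ∑ q ∈ Finset.range Q, a q)).and
      (eventually_ge_atTop Q)).exists
    refine ⟨N, ?_⟩
    rw [Finset.sum_Ico_eq_sub _ hQN]; linarith
  classical
  refine ⟨Nat.find hex, Nat.find_spec hex, ?_⟩
  set N := Nat.find hex with hN
  have hspec : M0 ≤ ∑ q ∈ Finset.Ico Q N, a q := Nat.find_spec hex
  rcases Nat.eq_zero_or_pos N with h | h
  · rw [h] at hspec ⊢; simp at hspec ⊢; linarith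
  · have hlt : ∑ q ∈ Finset.Ico Q (N - 1), a q < M0 := by
      by_contra hc
      exact Nat.find_min hex (show N - 1 < Nat.find hex by omega) (not_lt.mp hc)
    by_cases hQ : Q ≤ N - 1
    · have : N = (N - 1) + 1 := by omega
      rw [this, Finset.sum_Ico_succ_top hQ]
      linarith [h1 (N - 1)]
    · have : Finset.Ico Q N = ∅ := by apply Finset.Ico_eq_empty; omega
      rw [this] at hspec ⊢; simp at hspec ⊢; linarith


/-- the fraction attached to an index -/
noncomputable def fx (i : Σ _ : ℕ, ℕ) : ℝ := (i.2 : ℝ) / i.1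

lemma fx_inj (S : Finset ℕ) (hS : ∀ q ∈ S, 2 ≤ q) (i j : Σ _ : ℕ, ℕ) (hi : i ∈ S.sigma cop) (hj : j ∈ S.sigma cop)
    (h : fx i = fx j) : i = j := by
  obtain ⟨q, p⟩ := i
  obtain ⟨q', p'⟩ := j
  simp only [Finset.mem_sigma] at hi hj
  have hq := hS q hi.1
  have hq' := hS q' hj.1
  have hp := hi.2
  have hp' := hj.2
  simp only [cop, Finset.mem_filter, Finset.mem_range] at hp hp'
  simp only [fx] at h
  rw [div_eq_div_iff (by positivity) (by positivity)] at h
  have h' : p * q' = p' * q := by exact_mod_cast h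
  have d1 : q ∣ q' := hp.2.dvd_of_dvd_mul_left (h' ▸ Dvd.intro_left p' rfl)
  have d2 : q' ∣ q := hp'.2.dvd_of_dvd_mul_left (h'.symm ▸ Dvd.intro_left p rfl)
  have e := Nat.dvd_antisymm d1 d2
  subst e
  have : p = p' := Nat.eq_of_mul_eq_mul_right (by omega) h'
  subst this
  rfl

lemma energy_total (s C : ℝ) (hC : ∀ q q' : ℕ, 2 ≤ q → 2 ≤ q' →
    ∀ r : ℝ, 0 < r → r ≤ 1 →
    ∑ z ∈ prs q q' r, |(z.1 : ℝ) / q - (z.2 : ℝ) / q'| ^ (-s)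
      ≤ C * r ^ ((1 - s) / 2) * (q.totient * q'.totient))
    (S : Finset ℕ) (hS : ∀ q ∈ S, 2 ≤ q) (ρ : ℕ → ℝ) (hρ : ∀ q, 0 ≤ ρ q) (r : ℝ) (hr0 : 0 < r) (hr1 : r ≤ 1) :
    ∑ i ∈ S.sigma cop, ρ i.1 ^ s * ∑ j ∈ (S.sigma cop).filter (fun j => fx i ≠ fx j ∧ |fx i - fx j| ≤ r),
      ρ j.1 ^ s * |fx i - fx j| ^ (-s)
    ≤ C * r ^ ((1 - s) / 2) * (∑ q ∈ S, q.totient * ρ q ^ s) ^ 2 := by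
  have e : ∑ i ∈ S.sigma cop, ρ i.1 ^ s * ∑ j ∈ (S.sigma cop).filter (fun j => fx i ≠ fx j ∧ |fx i - fx j| ≤ r),
      ρ j.1 ^ s * |fx i - fx j| ^ (-s)
      = ∑ q ∈ S, ∑ q' ∈ S, ρ q ^ s * ρ q' ^ s * ∑ z ∈ prs q q' r, |(z.1 : ℝ) / q - (z.2 : ℝ) / q'| ^ (-s) := by
    rw [Finset.sum_sigma]
    refine Finset.sum_congr rfl fun q _ => ?_
    simp_rw [Finset.sum_filter, Finset.sum_sigma, Finset.mul_sum]
    rw [Finset.sum_comm]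
    refine Finset.sum_congr rfl fun q' _ => ?_
    rw [prs, Finset.sum_filter, Finset.sum_product]
    refine Finset.sum_congr rfl fun p _ => ?_
    refine Finset.sum_congr rfl fun p' _ => ?_
    by_cases h : (p:ℝ)/q ≠ (p':ℝ)/q' ∧ |(p:ℝ)/q - (p':ℝ)/q'| ≤ r
    · have h' : fx ⟨q, p⟩ ≠ fx ⟨q', p'⟩ ∧ |fx ⟨q, p⟩ - fx ⟨q', p'⟩| ≤ r := h
      rw [if_pos h, if_pos h', mul_assoc]; rfl
    · have h' : ¬ (fx ⟨q, p⟩ ≠ fx ⟨q', p'⟩ ∧ |fx ⟨q, p⟩ - fx ⟨q', p'⟩| ≤ r) := h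
      rw [if_neg h, if_neg h', mul_zero]
  rw [e, sq, Finset.sum_mul_sum, Finset.mul_sum]
  refine Finset.sum_le_sum fun q hq => ?_
  rw [Finset.mul_sum]
  refine Finset.sum_le_sum fun q' hq' => ?_
  have h1 := hρ q
  have h2 := hρ q'
  calc _ ≤ ρ q ^ s * ρ q' ^ s * (C * r ^ ((1 - s) / 2) * (q.totient * q'.totient)) :=
        mul_le_mul_of_nonneg_left (hC q q' (hS q hq) (hS q' hq') r hr0 hr1) (by positivity)
    _ = _ := by ring

lemma total_equi (s : ℝ) (ρ : ℕ → ℝ) (hρ0 : ∀ q, 0 ≤ ρ q) (S : Finset ℕ) (hSρ : ∀ q ∈ S, 0 < ρ q)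
    (f : ℝ → ℝ) (hf : ContDiff ℝ 1 f) (δ a b : ℝ)
    (hq1 : ∀ q ∈ S, |(∫ x in a..b, f x * Hq (ρ q) q x) - (∫ x in a..b, f x) * q.totient| ≤ δ * q.totient) :
    |∑ i ∈ S.sigma cop, (ρ i.1 ^ s * ∫ x in a..b, f x * bmp (ρ i.1) (fx i) x)
      - (∫ x in a..b, f x) * ∑ q ∈ S, (q.totient : ℝ) * ρ q ^ s| ≤ δ * ∑ q ∈ S, (q.totient : ℝ) * ρ q ^ s := by
  have e1 : ∑ i ∈ S.sigma cop, (ρ i.1 ^ s * ∫ x in a..b, f x * bmp (ρ i.1) (fx i) x)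
      = ∑ q ∈ S, ρ q ^ s * ∫ x in a..b, f x * Hq (ρ q) q x := by
    rw [Finset.sum_sigma]
    refine Finset.sum_congr rfl fun q hq => ?_
    change ∑ p ∈ cop q, ρ q ^ s * ∫ x in a..b, f x * bmp (ρ q) ((p:ℝ)/q) x = _
    rw [← Finset.mul_sum]
    congr 1
    unfold Hq
    simp_rw [Finset.mul_sum]
    rw [intervalIntegral.integral_finsetSum]
    intro p _
    exact (hf.continuous.mul (bmp_contDiff _ _ (hSρ q hq)).continuous).intervalIntegrable _ _
  rw [e1, Finset.mul_sum, Finset.mul_sum, ← Finset.sum_sub_distrib]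
  refine (Finset.abs_sum_le_sum_abs _ _).trans (Finset.sum_le_sum fun q hq => ?_)
  have h := hq1 q hq
  have h2 : 0 ≤ ρ q ^ s := by have := hρ0 q; positivity
  calc _ = |ρ q ^ s * ((∫ x in a..b, f x * Hq (ρ q) q x) - (∫ x in a..b, f x) * q.totient)| := by
        congr 1; ring
    _ = ρ q ^ s * |(∫ x in a..b, f x * Hq (ρ q) q x) - (∫ x in a..b, f x) * q.totient| := by
        rw [abs_mul, abs_of_nonneg h2]
    _ ≤ ρ q ^ s * (δ * q.totient) := mul_le_mul_of_nonneg_left h h2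
    _ = _ := by ring

set_option maxHeartbeats 2000000 in
lemma step (s : ℝ) (hs0 : 0 < s) (hs1 : s < 1) (ρ : ℕ → ℝ) (hρ0 : ∀ q, 0 ≤ ρ q)
    (hρq : ∀ q : ℕ, 2 ≤ q → ρ q ≤ 1 / (2 * q)) (hρ1 : ∀ q : ℕ, q.totient * ρ q ^ s ≤ 1)
    (hns : ¬ Summable (fun q : ℕ => q.totient * ρ q ^ s))
    (f : ℝ → ℝ) (hf : ContDiff ℝ 1 f) (hf0 : ∀ x, 0 ≤ f x) (c c' R m : ℝ) (hc : 0 < c) (hcc : c < c')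
    (hbd : ∀ a b : ℝ, 0 ≤ a → a ≤ b → b ≤ 1 → b - a ≤ R → ∫ x in a..b, f x ≤ c * (b - a) ^ s)
    (hm : m < ∫ x in (0:ℝ)..1, f x) (n : ℕ) :
    ∃ g : ℝ → ℝ, ContDiff ℝ 1 g ∧ (∀ x, 0 ≤ g x) ∧ Function.support g ⊆ Function.support f ∧
      (tsupport g ⊆ {x | ∃ q : ℕ, n ≤ q ∧ ∃ p : ℕ, q.Coprime p ∧ 0 < ρ q ∧ 2 ≤ q ∧ |x - (p : ℝ) / q| ≤ ρ q}) ∧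
      (∀ a b : ℝ, 0 ≤ a → a ≤ b → b ≤ 1 → b - a ≤ R → ∫ x in a..b, g x ≤ c' * (b - a) ^ s) ∧
      m < ∫ x in (0:ℝ)..1, g x := by
  classical
  obtain ⟨F₀, hF₀⟩ := isCompact_Icc.exists_bound_of_continuousOn (s := Icc (0:ℝ) 1) hf.continuous.continuousOn
  obtain ⟨F, hFpos, hF⟩ : ∃ F : ℝ, 0 < F ∧ ∀ x ∈ Icc (0:ℝ) 1, f x ≤ F :=
    ⟨max F₀ 1, by positivity, fun x hx => (le_abs_self _).trans ((hF₀ x hx).trans (le_max_left _ _))⟩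
  obtain ⟨C, hC0, hC⟩ := energy_bound s hs0 hs1
  set η := (∫ x in (0:ℝ)..1, f x) - m with hη
  have hη0 : 0 < η := by linarith
  set M0 := 2 * F / c with hM0
  have hM0pos : 0 < M0 := by positivity
  obtain ⟨r0, hr0, hr01, hr0b⟩ : ∃ r0 : ℝ, 0 < r0 ∧ r0 ≤ 1 ∧
      F * (8 * (C * r0 ^ ((1 - s) / 2) * (M0 + 1))) ≤ η / 2 := by
    have hlim : Tendsto (fun r : ℝ => F * (8 * (C * r ^ ((1 - s) / 2) * (M0 + 1)))) (nhdsWithin 0 (Ioi 0)) (nhds 0) := by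
      have h1 : Tendsto (fun r : ℝ => r ^ ((1 - s) / 2)) (nhds 0) (nhds 0) := by
        have := (Real.continuousAt_rpow_const 0 ((1 - s) / 2) (Or.inr (by linarith))).tendsto
        rwa [Real.zero_rpow (by linarith)] at this
      have h2 := ((((h1.const_mul C).mul_const (M0 + 1)).const_mul 8).const_mul F).mono_left
        (nhdsWithin_le_nhds (s := Ioi 0))
      simpa using h2
    have hev := hlim.eventually (ge_mem_nhds (show (0:ℝ) < η / 2 by linarith))
    have hev2 : ∀ᶠ r : ℝ in nhdsWithin 0 (Ioi 0), r ∈ Ioc (0:ℝ) 1 :=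
      Ioc_mem_nhdsGT one_pos
    obtain ⟨r, h1, h2⟩ := (hev.and hev2).exists
    exact ⟨r, h2.1, h2.2, h1⟩
  set δ := min (η / 4) ((c' - c) * (r0 / 4) ^ s) with hδ
  have hδ0 : 0 < δ := by
    refine lt_min (by linarith) (mul_pos (by linarith) (by positivity))
  obtain ⟨Q1, hQ1⟩ := equi f hf δ hδ0
  obtain ⟨Q2, hQ2⟩ := exists_nat_gt (4 / r0)
  set Q := max (max Q1 Q2) (max n 2) with hQ
  obtain ⟨N, hN1, hN2⟩ := exists_block (fun q : ℕ => q.totient * ρ q ^ s)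
    (fun q => by have := hρ0 q; positivity) hρ1 hns M0 hM0pos Q
  set S := (Finset.Ico Q N).filter (fun q => 0 < ρ q) with hS
  have hSQ : ∀ q ∈ S, Q ≤ q := fun q hq => (Finset.mem_Ico.mp (Finset.mem_filter.mp hq).1).1
  have hSρ : ∀ q ∈ S, 0 < ρ q := fun q hq => (Finset.mem_filter.mp hq).2
  have hS2 : ∀ q ∈ S, 2 ≤ q := fun q hq =>
    ((le_max_right n 2).trans (le_max_right _ _)).trans (hSQ q hq)
  have hSn : ∀ q ∈ S, n ≤ q := fun q hq =>
    ((le_max_left n 2).trans (le_max_right _ _)).trans (hSQ q hq)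
  have hSQ1 : ∀ q ∈ S, Q1 ≤ q := fun q hq =>
    ((le_max_left Q1 Q2).trans (le_max_left _ _)).trans (hSQ q hq)
  have hSQ2 : ∀ q ∈ S, Q2 ≤ q := fun q hq =>
    ((le_max_right Q1 Q2).trans (le_max_left _ _)).trans (hSQ q hq)
  set M := ∑ q ∈ S, (q.totient : ℝ) * ρ q ^ s with hM
  have hMeq : M = ∑ q ∈ Finset.Ico Q N, (q.totient : ℝ) * ρ q ^ s := by
    rw [hM, hS]
    apply Finset.sum_subset (Finset.filter_subset _ _)
    intro q hq hq'
    have : ρ q = 0 := by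
      by_contra h
      exact hq' (Finset.mem_filter.mpr ⟨hq, lt_of_le_of_ne (hρ0 q) (Ne.symm h)⟩)
    rw [this, Real.zero_rpow hs0.ne', mul_zero]
  rw [← hMeq] at hN1 hN2
  have hMpos : 0 < M := lt_of_lt_of_le hM0pos hN1
  set I := S.sigma cop with hI
  have hIS : ∀ i ∈ I, i.1 ∈ S := fun i hi => (Finset.mem_sigma.mp hi).1
  set V : (Σ _ : ℕ, ℕ) → ℝ := fun i => ∑ j ∈ I.filter (fun j => fx i ≠ fx j ∧ |fx i - fx j| ≤ r0),
      ρ j.1 ^ s * |fx i - fx j| ^ (-s) with hV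
  have hVtot : ∑ i ∈ I, ρ i.1 ^ s * V i ≤ C * r0 ^ ((1 - s) / 2) * M ^ 2 :=
    energy_total s C hC S hS2 ρ hρ0 r0 hr0 hr01
  have hV0 : ∀ i, 0 ≤ V i := fun i => Finset.sum_nonneg fun j _ => by
    have := hρ0 j.1; positivity
  set G := I.filter (fun i => V i ≤ 1 / 8) with hG
  have hGI : G ⊆ I := Finset.filter_subset _ _
  set Bd := I.filter (fun i => ¬ V i ≤ 1 / 8) with hBd
  have hbad : ∑ i ∈ Bd, ρ i.1 ^ s ≤ 8 * (C * r0 ^ ((1 - s) / 2) * M ^ 2) := by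
    calc ∑ i ∈ Bd, ρ i.1 ^ s ≤ ∑ i ∈ Bd, 8 * (ρ i.1 ^ s * V i) := by
          refine Finset.sum_le_sum fun i hi => ?_
          have h1 := (Finset.mem_filter.mp hi).2
          push Not at h1
          have h2 : 0 ≤ ρ i.1 ^ s := by have := hρ0 i.1; positivity
          nlinarith
      _ ≤ ∑ i ∈ I, 8 * (ρ i.1 ^ s * V i) := by
          refine Finset.sum_le_sum_of_subset_of_nonneg (Finset.filter_subset _ _) fun i _ _ => ?_
          have h2 : 0 ≤ ρ i.1 ^ s := by have := hρ0 i.1; positivity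
          have := hV0 i
          positivity
      _ = 8 * ∑ i ∈ I, ρ i.1 ^ s * V i := by rw [Finset.mul_sum]
      _ ≤ _ := by linarith
  set J : (Σ _ : ℕ, ℕ) → ℝ → ℝ → ℝ := fun i a b => ρ i.1 ^ s * ∫ x in a..b, f x * bmp (ρ i.1) (fx i) x with hJ
  have hbc : ∀ i ∈ I, ContDiff ℝ 1 (bmp (ρ i.1) (fx i)) := fun i hi => bmp_contDiff _ _ (hSρ _ (hIS i hi))
  have hJ0 : ∀ i, ∀ a b, a ≤ b → 0 ≤ J i a b := fun i a b hab => by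
    have h2 : 0 ≤ ρ i.1 ^ s := by have := hρ0 i.1; positivity
    refine mul_nonneg h2 (intervalIntegral.integral_nonneg hab fun x _ => mul_nonneg (hf0 x) (bmp_nonneg _ _ _))
  have hJle : ∀ i ∈ I, ∀ a b, 0 ≤ a → a ≤ b → b ≤ 1 →
      J i a b ≤ F * (ρ i.1 ^ s * ∫ x in a..b, bmp (ρ i.1) (fx i) x) := by
    intro i hi a b ha hab hb
    have h2 : 0 ≤ ρ i.1 ^ s := by have := hρ0 i.1; positivity
    have hcont := (hbc i hi).continuous
    have : ∫ x in a..b, f x * bmp (ρ i.1) (fx i) x ≤ ∫ x in a..b, F * bmp (ρ i.1) (fx i) x := by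
      refine intervalIntegral.integral_mono_on hab ((hf.continuous.mul hcont).intervalIntegrable _ _)
        ((continuous_const.mul hcont).intervalIntegrable _ _) fun x hx => ?_
      exact mul_le_mul_of_nonneg_right (hF x ⟨by linarith [hx.1], by linarith [hx.2]⟩) (bmp_nonneg _ _ _)
    rw [intervalIntegral.integral_const_mul] at this
    calc J i a b ≤ ρ i.1 ^ s * (F * ∫ x in a..b, bmp (ρ i.1) (fx i) x) := mul_le_mul_of_nonneg_left this h2
      _ = _ := by ring
  have hJtot : ∀ a b, 0 ≤ a → a ≤ b → b ≤ 1 → |∑ i ∈ I, J i a b - (∫ x in a..b, f x) * M| ≤ δ * M :=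
    fun a b ha hab hb => total_equi s ρ hρ0 S hSρ f hf δ a b
      fun q hq => hQ1 q (hSQ1 q hq) (hS2 q hq) (ρ q) (hSρ q hq) (hρq q (hS2 q hq)) a b ha hab hb
  set g : ℝ → ℝ := fun x => f x * (M⁻¹ * ∑ i ∈ G, ρ i.1 ^ s * bmp (ρ i.1) (fx i) x) with hg
  have hgint : ∀ a b, ∫ x in a..b, g x = M⁻¹ * ∑ i ∈ G, J i a b := by
    intro a b
    simp only [hJ]
    simp_rw [← intervalIntegral.integral_const_mul]
    rw [← intervalIntegral.integral_finsetSum, ← intervalIntegral.integral_const_mul]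
    · congr 1; ext x; simp only [hg, Finset.mul_sum]
      refine Finset.sum_congr rfl fun i _ => by ring
    · intro i hi
      exact (continuous_const.mul (hf.continuous.mul (hbc i (hGI hi)).continuous)).intervalIntegrable _ _
  refine ⟨g, ?_, ?_, ?_, ?_, ?_, ?_⟩
  · refine hf.mul (contDiff_const.mul (ContDiff.sum fun i hi => contDiff_const.mul (hbc i (hGI hi))))
  · intro x
    refine mul_nonneg (hf0 x) (mul_nonneg (by positivity) (Finset.sum_nonneg fun i _ => ?_))
    have := hρ0 i.1
    exact mul_nonneg (by positivity) (bmp_nonneg _ _ _)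
  · intro x hx hfx
    apply hx
    simp only [hg, hfx, zero_mul]
  · have hcl : IsClosed (⋃ i ∈ G, Metric.closedBall (fx i) (ρ i.1)) :=
      isClosed_biUnion_finset fun i _ => Metric.isClosed_closedBall
    have hsub : tsupport g ⊆ ⋃ i ∈ G, Metric.closedBall (fx i) (ρ i.1) := by
      refine closure_minimal ?_ hcl
      intro x hx
      by_contra hnot
      apply hx
      have : ∑ i ∈ G, ρ i.1 ^ s * bmp (ρ i.1) (fx i) x = 0 := by
        refine Finset.sum_eq_zero fun i hi => ?_
        rw [bmp_eq_zero _ _ _ (hSρ _ (hIS i (hGI hi))), mul_zero]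
        by_contra hlt
        apply hnot
        simp only [Set.mem_iUnion]
        refine ⟨i, hi, ?_⟩
        rw [Metric.mem_closedBall, Real.dist_eq]; linarith
      simp only [hg, this, mul_zero]
    refine hsub.trans ?_
    intro x hx
    simp only [Set.mem_iUnion] at hx
    obtain ⟨i, hi, hx⟩ := hx
    rw [Metric.mem_closedBall, Real.dist_eq] at hx
    have hiS := hIS i (hGI hi)
    have hcop := (Finset.mem_sigma.mp (hGI hi)).2
    exact ⟨i.1, hSn _ hiS, i.2, (Finset.mem_filter.mp hcop).2, hSρ _ hiS, hS2 _ hiS, hx⟩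
  · intro a b ha hab hb hR
    rw [hgint]
    by_cases hsm : b - a ≤ r0 / 4
    · have hcl := small_claim G fx (fun i => ρ i.1) s r0 hs0 hs1 (fun i hi => hSρ _ (hIS i (hGI hi)))
        (fun i hi => by
          have hiS := hIS i (hGI hi)
          have h1 := hρq i.1 (hS2 _ hiS)
          have h2 : (Q2 : ℝ) ≤ i.1 := by exact_mod_cast hSQ2 _ hiS
          have h3 : 4 / r0 < i.1 := lt_of_lt_of_le hQ2 h2
          rw [div_lt_iff₀ hr0] at h3
          have hpos : (0:ℝ) < i.1 := by have := hS2 _ hiS; positivity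
          rw [le_div_iff₀ (by positivity)] at h1
          have h4 : 0 ≤ ρ i.1 := hρ0 _
          show 8 * ρ i.1 ≤ r0
          by_contra hcon
          push Not at hcon
          nlinarith)
        (fun i hi j hj h => fx_inj S hS2 i j (hGI hi) (hGI hj) h)
        (fun i hi => by
          refine le_trans ?_ (Finset.mem_filter.mp hi).2
          refine Finset.sum_le_sum_of_subset_of_nonneg (Finset.filter_subset_filter _ hGI) fun j _ _ => ?_
          have := hρ0 j.1
          positivity) a b hab hsm
      have h1 : ∑ i ∈ G, J i a b ≤ F * (2 * (b - a) ^ s) := by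
        calc ∑ i ∈ G, J i a b ≤ ∑ i ∈ G, F * (ρ i.1 ^ s * ∫ x in a..b, bmp (ρ i.1) (fx i) x) :=
              Finset.sum_le_sum fun i hi => hJle i (hGI hi) a b ha hab hb
          _ = F * ∑ i ∈ G, (ρ i.1 ^ s * ∫ x in a..b, bmp (ρ i.1) (fx i) x) := by rw [Finset.mul_sum]
          _ ≤ _ := mul_le_mul_of_nonneg_left hcl hFpos.le
      have hpow : 0 ≤ (b - a) ^ s := Real.rpow_nonneg (by linarith) _
      have h2 : 2 * F ≤ c * M := by
        have := hN1
        rw [hM0, div_le_iff₀ hc] at this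
        linarith
      rw [inv_mul_le_iff₀ hMpos]
      have h3 := mul_le_mul_of_nonneg_right h2 hpow
      have h4 := mul_le_mul_of_nonneg_right (mul_le_mul_of_nonneg_right hcc.le hMpos.le) hpow
      linarith
    · push Not at hsm
      have h1 : ∑ i ∈ G, J i a b ≤ ∑ i ∈ I, J i a b :=
        Finset.sum_le_sum_of_subset_of_nonneg hGI fun i _ _ => hJ0 i a b hab
      have h2 := (abs_le.mp (hJtot a b ha hab hb)).2
      have h3 := hbd a b ha hab hb hR
      have h4 : δ ≤ (c' - c) * (b - a) ^ s := (min_le_right _ _).trans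
        (mul_le_mul_of_nonneg_left (Real.rpow_le_rpow (by positivity) hsm.le hs0.le) (by linarith))
      rw [inv_mul_le_iff₀ hMpos]
      nlinarith
  · rw [hgint]
    have h1 : ∑ i ∈ G, J i 0 1 + ∑ i ∈ Bd, J i 0 1 = ∑ i ∈ I, J i 0 1 :=
      Finset.sum_filter_add_sum_filter_not I _ _
    have h2 := (abs_le.mp (hJtot 0 1 le_rfl zero_le_one le_rfl)).1
    have h3 : ∑ i ∈ Bd, J i 0 1 ≤ F * (8 * (C * r0 ^ ((1 - s) / 2) * M ^ 2)) := by
      calc ∑ i ∈ Bd, J i 0 1 ≤ ∑ i ∈ Bd, F * ρ i.1 ^ s := by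
            refine Finset.sum_le_sum fun i hi => ?_
            have hiI : i ∈ I := (Finset.mem_filter.mp hi).1
            refine (hJle i hiI 0 1 le_rfl zero_le_one le_rfl).trans ?_
            have h2 : 0 ≤ ρ i.1 ^ s := by have := hρ0 i.1; positivity
            refine mul_le_mul_of_nonneg_left ?_ hFpos.le
            exact mul_le_of_le_one_right h2 (bmp_int_le_one _ _ _ _ (hSρ _ (hIS i hiI)) zero_le_one)
        _ = F * ∑ i ∈ Bd, ρ i.1 ^ s := by rw [Finset.mul_sum]
        _ ≤ _ := mul_le_mul_of_nonneg_left hbad hFpos.le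
    have h4 : F * (8 * (C * r0 ^ ((1 - s) / 2) * M ^ 2)) ≤ η / 2 * M := by
      have h5 : F * (8 * (C * r0 ^ ((1 - s) / 2) * M)) ≤ η / 2 := by
        refine le_trans ?_ hr0b
        gcongr
      calc _ = F * (8 * (C * r0 ^ ((1 - s) / 2) * M)) * M := by ring
        _ ≤ _ := mul_le_mul_of_nonneg_right h5 hMpos.le
    have h6 : δ ≤ η / 4 := min_le_left _ _
    rw [lt_inv_mul_iff₀ hMpos]
    have h7 : (∫ x in (0:ℝ)..1, f x) = m + η := by rw [hη]; ring
    rw [h7] at h2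
    nlinarith


lemma exists_rho (ψ : ℕ → ℝ) (hψ : ∀ q, ψ q ∈ Set.Ico (0 : ℝ) (1 / 2))
    (s : ℝ) (hs0 : 0 < s)
    (hdiv : ∑' q : ℕ, ENNReal.ofReal ((ψ q / (q : ℝ)) ^ s * (q : ℕ).totient) = ⊤) :
    ∃ ρ : ℕ → ℝ, (∀ q, 0 ≤ ρ q) ∧ (∀ q : ℕ, 2 ≤ q → ρ q ≤ 1 / (2 * q)) ∧
      (∀ q : ℕ, q.totient * ρ q ^ s ≤ 1) ∧ ¬ Summable (fun q : ℕ => q.totient * ρ q ^ s) ∧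
      ∀ q : ℕ, 2 ≤ q → 0 < ρ q → q * ρ q < ψ q := by
  set B : ℕ → ℝ := fun q => (q.totient : ℝ) ^ (-(1 / s)) with hB
  have hB0 : ∀ q, 0 ≤ B q := fun q => by simp only [hB]; positivity
  have hBs : ∀ q : ℕ, 1 ≤ q → q.totient * B q ^ s = 1 := by
    intro q hq
    have hpos : (0:ℝ) < q.totient := by exact_mod_cast Nat.totient_pos.mpr hq
    simp only [hB]
    rw [← Real.rpow_mul hpos.le, show -(1 / s) * s = -1 by field_simp, Real.rpow_neg_one,
      mul_inv_cancel₀ hpos.ne']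
  have hA0 : ∀ q : ℕ, 0 ≤ ψ q / (2 * q) := fun q => div_nonneg (hψ q).1 (by positivity)
  refine ⟨fun q => min (ψ q / (2 * q)) (B q), fun q => le_min (hA0 q) (hB0 q), ?_, ?_, ?_, ?_⟩
  · intro q hq
    refine (min_le_left _ _).trans ?_
    have := (hψ q).2
    gcongr
    linarith
  · intro q
    rcases Nat.eq_zero_or_pos q with h | h
    · subst h; simp
    · rw [← hBs q h]
      refine mul_le_mul_of_nonneg_left ?_ (by positivity)
      exact Real.rpow_le_rpow (le_min (hA0 q) (hB0 q)) (min_le_right _ _) hs0.le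
  · intro hsum
    have hlim := hsum.tendsto_atTop_zero
    have hev : ∀ᶠ q : ℕ in atTop, q.totient * (min (ψ q / (2 * q)) (B q)) ^ s < 1 :=
      hlim.eventually (gt_mem_nhds one_pos)
    have hs2 : Summable (fun q : ℕ => (ψ q / (q : ℝ)) ^ s * (q : ℕ).totient) := by
      refine (hsum.mul_left ((2:ℝ) ^ s)).of_norm_bounded_eventually_nat ?_
      filter_upwards [hev, eventually_ge_atTop 1] with q hq hq1
      have hle : ψ q / (2 * q) ≤ B q := by
        by_contra hcon
        push Not at hcon
        rw [min_eq_right hcon.le, hBs q hq1] at hq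
        exact lt_irrefl _ hq
      rw [min_eq_left hle]
      have h1 : 0 ≤ ψ q / (q:ℝ) := div_nonneg (hψ q).1 (by positivity)
      rw [Real.norm_of_nonneg (by positivity)]
      have : ψ q / (q:ℝ) = 2 * (ψ q / (2 * q)) := by field_simp
      rw [this, Real.mul_rpow (by norm_num) (hA0 q)]
      apply le_of_eq
      ring
    have := ENNReal.ofReal_tsum_of_nonneg (fun q => by
      have h1 : 0 ≤ ψ q / (q:ℝ) := div_nonneg (hψ q).1 (by positivity)
      positivity) hs2
    rw [hdiv] at this
    exact ENNReal.ofReal_ne_top this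
  · intro q hq hpos
    have hq0 : (0:ℝ) < q := by positivity
    have h1 : 0 < ψ q / (2 * q) := lt_of_lt_of_le hpos (min_le_left _ _)
    have h2 : 0 < ψ q := by
      rcases (hψ q).1.eq_or_lt with h | h
      · rw [← h] at h1; simp at h1
      · exact h
    have h3 := mul_le_mul_of_nonneg_left (min_le_left (ψ q / (2 * q)) (B q)) hq0.le
    have h4 : (q:ℝ) * (ψ q / (2 * q)) = ψ q / 2 := by field_simp
    linarith

lemma exists_seq (s : ℝ) (hs0 : 0 < s) (hs1 : s < 1) (ρ : ℕ → ℝ) (hρ0 : ∀ q, 0 ≤ ρ q)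
    (hρq : ∀ q : ℕ, 2 ≤ q → ρ q ≤ 1 / (2 * q)) (hρ1 : ∀ q : ℕ, q.totient * ρ q ^ s ≤ 1)
    (hns : ¬ Summable (fun q : ℕ => q.totient * ρ q ^ s)) (κ : ℝ) (hκ : 0 < κ) :
    ∃ R : ℝ, 0 < R ∧ ∃ f : ℕ → ℝ → ℝ, (∀ k, Continuous (f k)) ∧ (∀ k x, 0 ≤ f k x) ∧
      (∀ k, Function.support (f (k + 1)) ⊆ Function.support (f k)) ∧
      (∀ k, tsupport (f (k + 1)) ⊆ {x | ∃ q : ℕ, k ≤ q ∧ ∃ p : ℕ, q.Coprime p ∧ 0 < ρ q ∧ 2 ≤ q ∧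
        |x - (p : ℝ) / q| ≤ ρ q}) ∧
      (∀ k, ∀ a b : ℝ, 0 ≤ a → a ≤ b → b ≤ 1 → b - a ≤ R → ∫ x in a..b, f k x ≤ 2 * κ * (b - a) ^ s) ∧
      ∀ k, 1 / 2 < ∫ x in (0:ℝ)..1, f k x := by
  set R : ℝ := κ ^ (1 / (1 - s)) with hR
  have hR0 : 0 < R := by positivity
  have hRp : R ^ (1 - s) = κ := by
    rw [hR, ← Real.rpow_mul hκ.le, one_div, inv_mul_cancel₀ (by linarith), Real.rpow_one]
  refine ⟨R, hR0, ?_⟩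
  let P : (ℝ → ℝ) × ℝ → Prop := fun z => ContDiff ℝ 1 z.1 ∧ (∀ x, 0 ≤ z.1 x) ∧ 0 < z.2 ∧ z.2 < 2 * κ ∧
    (∀ a b : ℝ, 0 ≤ a → a ≤ b → b ≤ 1 → b - a ≤ R → ∫ x in a..b, z.1 x ≤ z.2 * (b - a) ^ s) ∧
    1 / 2 < ∫ x in (0:ℝ)..1, z.1 x
  have hstep : ∀ (n : ℕ) (z : {z // P z}), ∃ w : {z // P z},
      Function.support w.1.1 ⊆ Function.support z.1.1 ∧
      tsupport w.1.1 ⊆ {x | ∃ q : ℕ, n ≤ q ∧ ∃ p : ℕ, q.Coprime p ∧ 0 < ρ q ∧ 2 ≤ q ∧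
        |x - (p : ℝ) / q| ≤ ρ q} := by
    rintro n ⟨⟨f, c⟩, h1, h2, h3, h4, h5, h6⟩
    dsimp only at h1 h2 h3 h4 h5 h6
    obtain ⟨g, g1, g2, g3, g4, g5, g6⟩ := step s hs0 hs1 ρ hρ0 hρq hρ1 hns f h1 h2 c ((c + 2 * κ) / 2) R (1 / 2) h3
      (by linarith) h5 h6 n
    exact ⟨⟨⟨g, (c + 2 * κ) / 2⟩, g1, g2, by dsimp only; linarith, by dsimp only; linarith, g5, g6⟩, g3, g4⟩
  choose F hF1 hF2 using hstep
  have hP0 : P ⟨fun _ => 1, κ⟩ := by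
    refine ⟨contDiff_const, fun _ => zero_le_one, hκ, by dsimp only; linarith, ?_, ?_⟩
    · intro a b ha hab hb hr
      dsimp only
      rw [intervalIntegral.integral_const, smul_eq_mul, mul_one]
      rcases hab.eq_or_lt with h | h
      · subst h; simp [Real.zero_rpow hs0.ne']
      · have h0 : 0 < b - a := by linarith
        calc b - a = (b - a) ^ (1 - s) * (b - a) ^ s := by
              rw [← Real.rpow_add h0]; simp
          _ ≤ κ * (b - a) ^ s := by
              refine mul_le_mul_of_nonneg_right ?_ (by positivity)
              rw [← hRp]
              exact Real.rpow_le_rpow h0.le hr (by linarith)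
    · dsimp only
      rw [intervalIntegral.integral_const]; norm_num
  let sq : ℕ → {z // P z} := fun k => Nat.rec ⟨_, hP0⟩ (fun n z => F n z) k
  refine ⟨fun k => (sq k).1.1, fun k => (sq k).2.1.continuous, fun k => (sq k).2.2.1,
    fun k => hF1 k (sq k), fun k => hF2 k (sq k), ?_, fun k => (sq k).2.2.2.2.2.2⟩
  intro k a b ha hab hb hr
  refine ((sq k).2.2.2.2.2.1 a b ha hab hb hr).trans ?_
  exact mul_le_mul_of_nonneg_right (sq k).2.2.2.2.1.le (Real.rpow_nonneg (by linarith) _)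

lemma cover_bound (s K R : ℝ) (hs0 : 0 < s) (hK : 0 ≤ K) (f : ℝ → ℝ) (hf : Continuous f) (hf0 : ∀ x, 0 ≤ f x)
    (hbd : ∀ a b : ℝ, 0 ≤ a → a ≤ b → b ≤ 1 → b - a ≤ R → ∫ x in a..b, f x ≤ K * (b - a) ^ s)
    (T : Finset ℕ) (c d : ℕ → ℝ) (hcd : ∀ i, c i ≤ d i) (hdR : ∀ i, d i - c i ≤ R)
    (hcov : tsupport f ∩ Icc 0 1 ⊆ ⋃ i ∈ T, Ioo (c i) (d i)) :
    ∫ x in (0:ℝ)..1, f x ≤ ∑ i ∈ T, K * (d i - c i) ^ s := by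
  have hintg : ∀ i, IntegrableOn ((Ioc (c i) (d i)).indicator f) (Ioc 0 1) := fun i =>
    ((hf.integrableOn_Ioc).indicator measurableSet_Ioc)
  rw [intervalIntegral.integral_of_le zero_le_one]
  calc ∫ x in Ioc (0:ℝ) 1, f x ≤ ∫ x in Ioc (0:ℝ) 1, ∑ i ∈ T, (Ioc (c i) (d i)).indicator f x := by
        refine setIntegral_mono_on hf.integrableOn_Ioc (integrable_finsetSum _ fun i _ => hintg i)
          measurableSet_Ioc fun x hx => ?_
        by_cases hfx : f x = 0
        · rw [hfx]
          exact Finset.sum_nonneg fun i _ => indicator_nonneg (fun y _ => hf0 y) x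
        · have := hcov ⟨subset_tsupport f hfx, hx.1.le, hx.2⟩
          simp only [Set.mem_iUnion] at this
          obtain ⟨i, hi, hxi⟩ := this
          refine le_trans ?_ (Finset.single_le_sum
            (f := fun i => (Ioc (c i) (d i)).indicator f x)
            (fun i _ => indicator_nonneg (fun y _ => hf0 y) x) hi)
          rw [indicator_of_mem (Ioo_subset_Ioc_self hxi)]
    _ = ∑ i ∈ T, ∫ x in Ioc (0:ℝ) 1, (Ioc (c i) (d i)).indicator f x :=
        integral_finsetSum _ fun i _ => hintg i
    _ ≤ _ := by
        refine Finset.sum_le_sum fun i _ => ?_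
        rw [setIntegral_indicator measurableSet_Ioc, Ioc_inter_Ioc]
        have hp : 0 ≤ K * (d i - c i) ^ s := mul_nonneg hK (Real.rpow_nonneg (by linarith [hcd i]) _)
        by_cases hle : max 0 (c i) ≤ min 1 (d i)
        · change ∫ x in Ioc (max 0 (c i)) (min 1 (d i)), f x ≤ _
          rw [← intervalIntegral.integral_of_le hle]
          have hlen : min 1 (d i) - max 0 (c i) ≤ d i - c i :=
            sub_le_sub (min_le_right _ _) (le_max_right _ _)
          refine (hbd _ _ (le_max_left _ _) hle (min_le_left _ _) (hlen.trans (hdR i))).trans ?_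
          exact mul_le_mul_of_nonneg_left (Real.rpow_le_rpow (by linarith) hlen hs0.le) hK
        · change ∫ x in Ioc (max 0 (c i)) (min 1 (d i)), f x ≤ _
          rw [Ioc_eq_empty (by intro h; exact hle h.le)]
          simpa using hp

lemma enlarge (s : ℝ) (hs0 : 0 < s) (hs1 : s < 1) (R : ℝ) (hR : 0 < R) (t : Set ℝ)
    (ht : Metric.ediam t ≤ ENNReal.ofReal (R / 2)) (ε : NNReal) (hε : 0 < ε) :
    ∃ c d : ℝ, c ≤ d ∧ d - c ≤ R ∧ t ⊆ Ioo c d ∧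
      ENNReal.ofReal ((d - c) ^ s) ≤ (⨆ _ : t.Nonempty, Metric.ediam t ^ s) + ε := by
  rcases t.eq_empty_or_nonempty with h | h
  · subst h
    refine ⟨0, 0, le_rfl, by linarith, empty_subset _, ?_⟩
    simp [Real.zero_rpow hs0.ne']
  · have hb : Bornology.IsBounded t :=
      Metric.isBounded_iff_ediam_ne_top.mpr (ne_top_of_le_ne_top ENNReal.ofReal_ne_top ht)
    have hle : sInf t ≤ sSup t := Real.sInf_le_sSup t hb.bddBelow hb.bddAbove
    rw [Real.ediam_eq hb] at ht ⊢
    rw [ENNReal.ofReal_le_ofReal_iff (by linarith)] at ht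
    set θ : ℝ := min (R / 2) ((ε : ℝ) ^ (1 / s)) with hθ
    have hε' : (0:ℝ) < ε := hε
    have hθ0 : 0 < θ := lt_min (by linarith) (by positivity)
    have hθs : θ ^ s ≤ ε := by
      calc θ ^ s ≤ ((ε : ℝ) ^ (1 / s)) ^ s := Real.rpow_le_rpow hθ0.le (min_le_right _ _) hs0.le
        _ = ε := by rw [← Real.rpow_mul hε'.le, one_div, inv_mul_cancel₀ hs0.ne', Real.rpow_one]
    have hθR : θ ≤ R / 2 := min_le_left _ _
    refine ⟨sInf t - θ / 2, sSup t + θ / 2, by linarith, by linarith, ?_, ?_⟩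
    · intro x hx
      have h1 := csInf_le hb.bddBelow hx
      have h2 := le_csSup hb.bddAbove hx
      constructor <;> linarith
    · rw [iSup_pos h]
      have e : sSup t + θ / 2 - (sInf t - θ / 2) = (sSup t - sInf t) + θ := by ring
      rw [e, ← ENNReal.ofReal_rpow_of_nonneg (by linarith) hs0.le, ENNReal.ofReal_add (by linarith) hθ0.le]
      refine (ENNReal.rpow_add_le_add_rpow _ _ hs0.le hs1.le).trans ?_
      gcongr
      rw [ENNReal.ofReal_rpow_of_nonneg hθ0.le hs0.le]
      exact ENNReal.ofReal_le_of_le_toReal (by simpa using hθs)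

lemma haus_lower (ψ : ℕ → ℝ) (hψ : ∀ q, ψ q ∈ Set.Ico (0 : ℝ) (1 / 2))
    (s : ℝ) (hs0 : 0 < s) (hs1 : s < 1)
    (hdiv : ∑' q : ℕ, ENNReal.ofReal ((ψ q / (q : ℝ)) ^ s * (q : ℕ).totient) = ⊤) (κ : ℝ) (hκ : 0 < κ) :
    ENNReal.ofReal (1 / (8 * κ)) ≤ μH[s] {x : ℝ | x ∈ Set.Icc (0 : ℝ) 1 ∧
        {q : ℕ | ∃ p : ℤ, Int.gcd p q = 1 ∧ |q * x - p| < ψ q}.Infinite} := by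
  obtain ⟨ρ, hρ0, hρq, hρ1, hns, hρψ⟩ := exists_rho ψ hψ s hs0 hdiv
  obtain ⟨R, hR, f, hfc, hf0, hfs, hft, hfb, hfm⟩ := exists_seq s hs0 hs1 ρ hρ0 hρq hρ1 hns κ hκ
  rw [Measure.hausdorffMeasure_apply]
  refine le_iSup₂_of_le (ENNReal.ofReal (R / 2)) (by simpa using hR) ?_
  refine le_iInf fun t => le_iInf fun hcov => le_iInf fun htd => ?_
  obtain ⟨ε, hε0, hεs⟩ := ENNReal.exists_pos_sum_of_countable
    (ε := ENNReal.ofReal (1 / (8 * κ))) (by simpa using hκ) ℕ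
  choose c d hcd hdR htcd hpow using fun n => enlarge s hs0 hs1 R hR (t n) (htd n) (ε n) (hε0 n)
  have hanti : Antitone (fun k => tsupport (f k) ∩ Icc (0:ℝ) 1) := by
    refine antitone_nat_of_succ_le fun k => ?_
    exact inter_subset_inter_left _ (closure_mono (hfs k))
  have hcpt : ∀ k, IsCompact (tsupport (f k) ∩ Icc (0:ℝ) 1) := fun k =>
    isCompact_Icc.inter_left (isClosed_tsupport _)
  have hopen : IsOpen (⋃ n, Ioo (c n) (d n)) := isOpen_iUnion fun n => isOpen_Ioo
  obtain ⟨k, hk⟩ := exists_subset_nhds_of_isCompact (U := ⋃ n, Ioo (c n) (d n)) hanti.directed_ge hcpt (by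
    intro x hx
    refine hopen.mem_nhds ?_
    have hx' : ∀ k, x ∈ tsupport (f k) ∩ Icc (0:ℝ) 1 := fun k => mem_iInter.mp hx k
    have hxW : x ∈ {x : ℝ | x ∈ Set.Icc (0 : ℝ) 1 ∧
        {q : ℕ | ∃ p : ℤ, Int.gcd p q = 1 ∧ |q * x - p| < ψ q}.Infinite} := by
      refine ⟨(hx' 0).2, Set.infinite_of_forall_exists_gt fun n => ?_⟩
      obtain ⟨q, hq, p, hqp, hρp, hq2, hxq⟩ := hft (n + 1) (hx' (n + 1 + 1)).1
      refine ⟨q, ⟨p, ?_, ?_⟩, by omega⟩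
      · rw [Int.gcd_natCast_natCast]; exact hqp.symm
      · have hq0 : (0:ℝ) < q := by positivity
        have e : (q:ℝ) * x - ((p:ℤ):ℝ) = q * (x - p / q) := by push_cast; field_simp
        rw [e, abs_mul, abs_of_pos hq0]
        exact lt_of_le_of_lt (mul_le_mul_of_nonneg_left hxq hq0.le) (hρψ q hq2 hρp)
    obtain ⟨n, hn⟩ := mem_iUnion.mp (hcov hxW)
    exact mem_iUnion.mpr ⟨n, htcd n hn⟩)
  obtain ⟨T, hT⟩ := (hcpt k).elim_finite_subcover (fun n => Ioo (c n) (d n)) (fun n => isOpen_Ioo) hk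
  have hb := cover_bound s (2 * κ) R hs0 (by linarith) (f k) (hfc k) (hf0 k) (hfb k) T c d hcd hdR hT
  have hm := hfm k
  rw [← Finset.mul_sum] at hb
  have h1 : 1 / (4 * κ) ≤ ∑ i ∈ T, (d i - c i) ^ s := by
    rw [div_le_iff₀ (by positivity)]
    nlinarith
  have h2 : ENNReal.ofReal (1 / (4 * κ)) ≤ (∑' n, ⨆ _ : (t n).Nonempty, Metric.ediam (t n) ^ s)
      + ENNReal.ofReal (1 / (8 * κ)) := by
    calc ENNReal.ofReal (1 / (4 * κ)) ≤ ENNReal.ofReal (∑ i ∈ T, (d i - c i) ^ s) := ENNReal.ofReal_le_ofReal h1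
      _ = ∑ i ∈ T, ENNReal.ofReal ((d i - c i) ^ s) :=
          ENNReal.ofReal_sum_of_nonneg fun i _ => Real.rpow_nonneg (by linarith [hcd i]) _
      _ ≤ ∑' n, ENNReal.ofReal ((d n - c n) ^ s) := ENNReal.sum_le_tsum _
      _ ≤ ∑' n, ((⨆ _ : (t n).Nonempty, Metric.ediam (t n) ^ s) + ε n) := ENNReal.tsum_le_tsum hpow
      _ = (∑' n, ⨆ _ : (t n).Nonempty, Metric.ediam (t n) ^ s) + ∑' n, (ε n : ENNReal) := ENNReal.tsum_add
      _ ≤ _ := by gcongr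
  have e : 1 / (4 * κ) = 1 / (8 * κ) + 1 / (8 * κ) := by field_simp; norm_num
  rw [e, ENNReal.ofReal_add (by positivity) (by positivity)] at h2
  exact (ENNReal.add_le_add_iff_right ENNReal.ofReal_ne_top).mp h2

theorem mtp_consequence (ψ : ℕ → ℝ) (hψ : ∀ q, ψ q ∈ Set.Ico (0 : ℝ) (1 / 2))
    (s : ℝ) (hs : s ∈ Set.Ioo (0 : ℝ) 1)
    (hdiv : ∑' q : ℕ, ENNReal.ofReal ((ψ q / (q : ℝ)) ^ s * (q : ℕ).totient) = ⊤) :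
    μH[s] {x : ℝ | x ∈ Set.Icc (0 : ℝ) 1 ∧
        {q : ℕ | ∃ p : ℤ, Int.gcd p q = 1 ∧ |q * x - p| < ψ q}.Infinite} = ⊤ ∧
    ENNReal.ofReal s ≤
      dimH {x : ℝ | x ∈ Set.Icc (0 : ℝ) 1 ∧
        {q : ℕ | ∃ p : ℤ, Int.gcd p q = 1 ∧ |q * x - p| < ψ q}.Infinite} := by
  have htop : μH[s] {x : ℝ | x ∈ Set.Icc (0 : ℝ) 1 ∧
        {q : ℕ | ∃ p : ℤ, Int.gcd p q = 1 ∧ |q * x - p| < ψ q}.Infinite} = ⊤ := by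
    refine ENNReal.eq_top_of_forall_nnreal_le fun r => ?_
    have hκ : (0:ℝ) < 1 / (8 * ((r:ℝ) + 1)) := by positivity
    refine le_trans ?_ (haus_lower ψ hψ s hs.1 hs.2 hdiv _ hκ)
    have e : 1 / (8 * (1 / (8 * ((r:ℝ) + 1)))) = (r:ℝ) + 1 := by
      have : (r:ℝ) + 1 ≠ 0 := by positivity
      field_simp
    rw [e, ← ENNReal.ofReal_coe_nnreal]
    exact ENNReal.ofReal_le_ofReal (by linarith)
  refine ⟨htop, ?_⟩
  have h := le_dimH_of_hausdorffMeasure_eq_top (d := s.toNNReal) (by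
    rw [Real.coe_toNNReal s hs.1.le]; exact htop)
  exact h
end
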